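/- Let K be a number field of degree 6 over ℚ that is Galois over ℚ with cyclic Galois group, and suppose K contains elements α and β with α³ = 57α − 133 and β² = −7 (so K is the sextic cyclic CM field ℚ(α, √−7) of conductor 133, with class number 4 and whose cubic subfield has class number 1). Then there exist a generator σ of Gal(K/ℚ), a nonzero ideal 𝔠 of 𝒪_K, and a Shimura ideal character of type (σ, 𝔠). -/

import Mathlib

open NumberField

/-- The action of `τ ∈ Gal(K/ℚ)` on ideals of the ring of integers of `K`,
via the restriction of `τ` to `𝓞 K`. -/
noncomputable def idealConj {K : Type*} [Field K] [NumberField K] (τ : K ≃ₐ[ℚ] K)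
    (I : Ideal (𝓞 K)) : Ideal (𝓞 K) :=
  Ideal.map (galRestrict ℤ ℚ K (𝓞 K) τ) I

/-- The cubic subfield `F` of `K`: the fixed field of `ρ = σ³`. -/
noncomputable def cubicFixedField {K : Type*} [Field K] [NumberField K] (σ : K ≃ₐ[ℚ] K) :
    IntermediateField ℚ K :=
  IntermediateField.fixedField (Subgroup.zpowers (σ ^ 3))

/-- A *Shimura ideal character of type `(σ, 𝔠)`* on a sextic cyclic CM field `K` with
`σ` a generator of `Gal(K/ℚ)`, `ρ = σ³`, and `F` the cubic subfield (fixed field of `ρ`):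
a map `ψ` from the nonzero ideals of `𝓞 K` coprime to `𝔠` to the nonzero elements of `K`
such that
(i)   `ψ (I * J) = ψ I * ψ J`;
(ii)  `ψ (s 𝓞 K) = s • σ⁴ s • σ⁵ s` whenever `s ≡ 1 mod 𝔠`;
(iii) for a prime `𝔭` of `𝓞 F` unramified in `K` (coprime to `𝔠`), `ψ (𝔭 𝓞 K) = N 𝔭`
      if `𝔭` splits in `K` and `ψ (𝔭 𝓞 K) = -N 𝔭` if `𝔭 𝓞 K` is prime;
(iv)  `ψ I * ρ (ψ I) = N I` and `ψ I • 𝓞 K = I • σ⁴ I • σ⁵ I` as (fractional) ideals;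
(v)   `ψ (σ I) = σ (ψ I)`.
Here the absolute norm `N` of an ideal is the cardinality of the corresponding quotient. -/
noncomputable def IsShimuraIdealChar {K : Type*} [Field K] [NumberField K]
    (σ : K ≃ₐ[ℚ] K) (𝔠 : Ideal (𝓞 K)) (ψ : Ideal (𝓞 K) → K) : Prop :=
  -- ψ takes nonzero values on nonzero ideals coprime to 𝔠
  (∀ I : Ideal (𝓞 K), I ≠ ⊥ → IsCoprime I 𝔠 → ψ I ≠ 0) ∧
  -- (i) multiplicativity
  (∀ I J : Ideal (𝓞 K), I ≠ ⊥ → J ≠ ⊥ → IsCoprime I 𝔠 → IsCoprime J 𝔠 →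
    ψ (I * J) = ψ I * ψ J) ∧
  -- (ii) value on principal ideals generated by `s ≡ 1 mod 𝔠`
  (∀ s : 𝓞 K, IsCoprime (Ideal.span {s}) 𝔠 → s - 1 ∈ 𝔠 →
    ψ (Ideal.span {s}) = (s : K) * (σ ^ 4) (s : K) * (σ ^ 5) (s : K)) ∧
  -- (iii) value on primes of the cubic subfield `F` unramified in `K`: such a prime either
  -- splits (`𝔭 𝓞 K` is a product of two distinct primes) or is inert (`𝔭 𝓞 K` is prime)
  (∀ 𝔭 : Ideal (𝓞 (cubicFixedField σ)), 𝔭.IsPrime → 𝔭 ≠ ⊥ →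
    IsCoprime (Ideal.map (algebraMap (𝓞 (cubicFixedField σ)) (𝓞 K)) 𝔭) 𝔠 →
    ((∃ Q₁ Q₂ : Ideal (𝓞 K), Q₁.IsPrime ∧ Q₂.IsPrime ∧ Q₁ ≠ Q₂ ∧
        Ideal.map (algebraMap (𝓞 (cubicFixedField σ)) (𝓞 K)) 𝔭 = Q₁ * Q₂) →
      ψ (Ideal.map (algebraMap (𝓞 (cubicFixedField σ)) (𝓞 K)) 𝔭)
        = (Nat.card (𝓞 (cubicFixedField σ) ⧸ 𝔭) : K)) ∧
    ((Ideal.map (algebraMap (𝓞 (cubicFixedField σ)) (𝓞 K)) 𝔭).IsPrime →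
      ψ (Ideal.map (algebraMap (𝓞 (cubicFixedField σ)) (𝓞 K)) 𝔭)
        = -(Nat.card (𝓞 (cubicFixedField σ) ⧸ 𝔭) : K))) ∧
  -- (iv) norm relation and ideal generation
  (∀ I : Ideal (𝓞 K), I ≠ ⊥ → IsCoprime I 𝔠 →
    ψ I * (σ ^ 3) (ψ I) = (Nat.card (𝓞 K ⧸ I) : K) ∧
    FractionalIdeal.spanSingleton (nonZeroDivisors (𝓞 K)) (ψ I)
      = ((I * idealConj (σ ^ 4) I * idealConj (σ ^ 5) I : Ideal (𝓞 K)) :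
          FractionalIdeal (nonZeroDivisors (𝓞 K)) K)) ∧
  -- (v) Galois equivariance with respect to σ
  (∀ I : Ideal (𝓞 K), I ≠ ⊥ → IsCoprime I 𝔠 → ψ (idealConj σ I) = σ (ψ I))

open NumberField

namespace Shim

/-- The basic data: a generator `σ`, its restriction `g` to the ring of integers, and the explicit
integers `y` (a cubic one) and `w = (1 + √-7) / 2`. -/
structure SD {K : Type*} [Field K] [NumberField K] (σ : K ≃ₐ[ℚ] K)
    (g : 𝓞 K ≃ₐ[ℤ] 𝓞 K) (y w : 𝓞 K) : Prop where
  hg : g = galRestrict ℤ ℚ K (𝓞 K) σ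
  fr : Module.finrank ℚ K = 6
  gal : IsGalois ℚ K
  gen : ∀ τ : K ≃ₐ[ℚ] K, τ ∈ Subgroup.zpowers σ
  hy : y ^ 3 = y ^ 2 + 6 * y - 7
  hw : w ^ 2 = w - 2
  gy : g y = y ^ 2 - 4
  gw : g w = 1 - w

theorem exists_SD (K : Type*) [Field K] [NumberField K]
    (hdeg : Module.finrank ℚ K = 6) [IsGalois ℚ K] (hcyc : IsCyclic (K ≃ₐ[ℚ] K))
    (α β : K) (hα : α ^ 3 = 57 * α - 133) (hβ : β ^ 2 = (-7 : K)) :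
    ∃ (σ : K ≃ₐ[ℚ] K) (g : 𝓞 K ≃ₐ[ℤ] 𝓞 K) (y w : 𝓞 K), SD σ g y w := by
  obtain ⟨σ₀, hσ₀⟩ := hcyc.exists_generator
  set y : K := (α + 1) / 3 with hydef
  set w : K := (1 + β) / 2 with hwdef
  have hy : y ^ 3 = y ^ 2 + 6 * y - 7 := by
    rw [hydef]; field_simp; linear_combination hα
  have hw : w ^ 2 = w - 2 := by
    rw [hwdef]; field_simp; linear_combination hβ
  clear_value y w
  have fixed : ∀ x : K, σ₀ x = x → ∃ q : ℚ, (q : K) = x := by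
    intro x hx
    have : x ∈ (⊥ : IntermediateField ℚ K) := by
      rw [IsGalois.mem_bot_iff_fixed]
      intro f
      obtain ⟨j, rfl⟩ := Subgroup.mem_zpowers_iff.1 (hσ₀ f)
      have h1 : σ₀ ∈ MulAction.stabilizer (K ≃ₐ[ℚ] K) x := hx
      exact Subgroup.zpow_mem _ h1 j
    obtain ⟨q, hq⟩ := IntermediateField.mem_bot.1 this
    exact ⟨q, by simpa using hq⟩
  have hσw : σ₀ w = 1 - w := by
    have h1 : (σ₀ w) ^ 2 = σ₀ w - 2 := by
      rw [← map_pow, hw, map_sub, map_ofNat]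
    have h2 : (σ₀ w - w) * (σ₀ w - (1 - w)) = 0 := by linear_combination h1 - hw
    rcases mul_eq_zero.1 h2 with h | h
    · exfalso
      obtain ⟨q, hq⟩ := fixed w (sub_eq_zero.1 h)
      rw [← hq] at hw
      have : q ^ 2 = q - 2 := by exact_mod_cast hw
      nlinarith [sq_nonneg (2 * q - 1)]
    · exact sub_eq_zero.1 h
  have hσy : σ₀ y = y ^ 2 - 4 ∨ σ₀ y = 5 - y - y ^ 2 := by
    have h1 : (σ₀ y) ^ 3 = (σ₀ y) ^ 2 + 6 * σ₀ y - 7 := by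
      rw [← map_pow, hy, map_sub, map_add, map_mul, map_ofNat, map_ofNat, map_pow]
    have h2 : (σ₀ y - y) * ((σ₀ y - (y ^ 2 - 4)) * (σ₀ y - (5 - y - y ^ 2))) = 0 := by
      linear_combination h1 + (σ₀ y * (-y - 2) + (y ^ 2 + 2 * y - 1)) * hy
    rcases mul_eq_zero.1 h2 with h | h
    · exfalso
      obtain ⟨q, hq⟩ := fixed y (sub_eq_zero.1 h)
      rw [← hq] at hy
      have h3 : q ^ 3 = q ^ 2 + 6 * q - 7 := by exact_mod_cast hy
      have h4 : IsIntegral ℤ q := by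
        refine ⟨.X ^ 3 - .X ^ 2 - .C 6 * .X + .C 7, by monicity!, ?_⟩
        simp; linarith
      obtain ⟨n, hn⟩ := IsIntegrallyClosed.isIntegral_iff.1 h4
      have h5 : n ^ 3 = n ^ 2 + 6 * n - 7 := by
        have : ((n : ℚ)) = q := by simpa using hn
        rw [← this] at h3; exact_mod_cast h3
      have h6 : ((n : ZMod 2)) ^ 3 = (n : ZMod 2) ^ 2 + 6 * n - 7 := by exact_mod_cast congrArg _ h5
      generalize (n : ZMod 2) = m at h6
      revert h6; revert m; decide
    · rcases mul_eq_zero.1 h with h | h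
      · exact Or.inl (sub_eq_zero.1 h)
      · exact Or.inr (sub_eq_zero.1 h)
  have hyi : IsIntegral ℤ y := by
    refine ⟨.X ^ 3 - .X ^ 2 - .C 6 * .X + .C 7, by monicity!, ?_⟩
    simp; rw [hy]; ring
  have hwi : IsIntegral ℤ w := by
    refine ⟨.X ^ 2 - .X + .C 2, by monicity!, ?_⟩
    simp; rw [hw]; ring
  obtain ⟨Y, rfl⟩ := (IsIntegralClosure.isIntegral_iff (A := 𝓞 K)).1 hyi
  obtain ⟨W, rfl⟩ := (IsIntegralClosure.isIntegral_iff (A := 𝓞 K)).1 hwi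
  have inj := FaithfulSMul.algebraMap_injective (𝓞 K) K
  have key : ∀ σ : K ≃ₐ[ℚ] K, (∀ τ : K ≃ₐ[ℚ] K, τ ∈ Subgroup.zpowers σ) →
      σ (algebraMap (𝓞 K) K Y) = (algebraMap (𝓞 K) K Y) ^ 2 - 4 →
      σ (algebraMap (𝓞 K) K W) = 1 - (algebraMap (𝓞 K) K W) →
      ∃ (σ : K ≃ₐ[ℚ] K) (g : 𝓞 K ≃ₐ[ℤ] 𝓞 K) (y w : 𝓞 K), SD σ g y w := by
    intro σ h1 h2 h3
    refine ⟨σ, galRestrict ℤ ℚ K (𝓞 K) σ, Y, W, rfl, hdeg, inferInstance, h1, ?_, ?_, ?_, ?_⟩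
    · apply inj; simp only [map_pow, map_add, map_sub, map_mul, map_ofNat]; exact hy
    · apply inj; simp only [map_pow, map_add, map_sub, map_mul, map_ofNat]; exact hw
    · apply inj
      rw [algebraMap_galRestrict_apply, h2]
      simp only [map_pow, map_add, map_sub, map_mul, map_ofNat]
    · apply inj
      rw [algebraMap_galRestrict_apply, h3]
      simp only [map_one, map_sub]
  rcases hσy with h | h
  · exact key σ₀ hσ₀ h hσw
  · refine key σ₀⁻¹ (by simpa [Subgroup.zpowers_inv] using hσ₀) ?_ ?_
    · change σ₀.symm (algebraMap (𝓞 K) K Y) = _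
      rw [AlgEquiv.symm_apply_eq]
      simp only [map_sub, map_pow, h]
      rw [map_ofNat]
      linear_combination (-(algebraMap (𝓞 K) K Y) - 3) * hy
    · change σ₀.symm (algebraMap (𝓞 K) K W) = _
      rw [AlgEquiv.symm_apply_eq]
      simp [hσw]

end Shim

open NumberField

namespace Shim

section
set_option linter.unusedSectionVars false
variable {K : Type*} [Field K] [NumberField K] {σ : K ≃ₐ[ℚ] K}
    {g : 𝓞 K ≃ₐ[ℤ] 𝓞 K} {y w : 𝓞 K}

theorem SD.coe (h : SD σ g y w) (x : 𝓞 K) :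
    algebraMap (𝓞 K) K (g x) = σ (algebraMap (𝓞 K) K x) := by
  rw [h.hg, algebraMap_galRestrict_apply]

theorem SD.ord (h : SD σ g y w) : orderOf σ = 6 := by
  have := h.gal
  rw [orderOf_eq_card_of_forall_mem_zpowers h.gen, IsGalois.card_aut_eq_finrank, h.fr]

theorem SD.s6 (h : SD σ g y w) (x : K) : σ (σ (σ (σ (σ (σ x))))) = x := by
  have h1 : σ ^ 6 = 1 := by rw [← h.ord]; exact pow_orderOf_eq_one σ
  exact congrArg (fun f : K ≃ₐ[ℚ] K => f x) h1

theorem inj : Function.Injective (algebraMap (𝓞 K) K) := FaithfulSMul.algebraMap_injective (𝓞 K) K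

theorem SD.g6 (h : SD σ g y w) (x : 𝓞 K) : g (g (g (g (g (g x))))) = x := by
  apply inj
  simp only [h.coe, h.s6]

theorem SD.fixed (h : SD σ g y w) (x : 𝓞 K) (hx : g x = x) : ∃ m : ℤ, x = (m : 𝓞 K) := by
  have := h.gal
  have h1 : algebraMap (𝓞 K) K x ∈ (⊥ : IntermediateField ℚ K) := by
    rw [IsGalois.mem_bot_iff_fixed]
    intro f
    obtain ⟨j, rfl⟩ := Subgroup.mem_zpowers_iff.1 (h.gen f)
    have h1 : σ ∈ MulAction.stabilizer (K ≃ₐ[ℚ] K) (algebraMap (𝓞 K) K x) := by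
      change σ _ = _
      rw [← h.coe, hx]
    exact Subgroup.zpow_mem _ h1 j
  obtain ⟨q, hq⟩ := IntermediateField.mem_bot.1 h1
  have h2 : IsIntegral ℤ q := by
    have h3 := RingOfIntegers.isIntegral_coe x
    rw [← hq] at h3
    exact (isIntegral_algebraMap_iff (algebraMap ℚ K).injective).1 h3
  obtain ⟨n, hn⟩ := IsIntegrallyClosed.isIntegral_iff.1 h2
  refine ⟨n, inj ?_⟩
  rw [← hq, ← hn]; simp

theorem SD.bij (h : SD σ g y w) :
    Function.Bijective (fun i : Fin 6 => (σ ^ (i : ℕ) : K ≃ₐ[ℚ] K)) := by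
  have := h.gal
  have hc : Fintype.card (K ≃ₐ[ℚ] K) = 6 := by
    rw [← Nat.card_eq_fintype_card, IsGalois.card_aut_eq_finrank, h.fr]
  rw [Fintype.bijective_iff_injective_and_card]
  refine ⟨?_, by simp [hc]⟩
  intro i j hij
  have := pow_injOn_Iio_orderOf (x := σ) (by simp [h.ord]) (by simp [h.ord]) hij
  exact Fin.ext this

theorem SD.norm_eq (h : SD σ g y w) (x : 𝓞 K) :
    ((Algebra.norm ℤ x : ℤ) : 𝓞 K) =
      x * g x * g (g x) * g (g (g x)) * g (g (g (g x))) * g (g (g (g (g x)))) := by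
  have := h.gal
  apply inj
  have h1 := Algebra.norm_eq_prod_automorphisms ℚ (algebraMap (𝓞 K) K x)
  rw [← h.bij.prod_comp (fun τ => τ (algebraMap (𝓞 K) K x)), Fin.prod_univ_six] at h1
  have h2 := Algebra.coe_norm_int x
  simp only [map_mul, h.coe]
  have h3 : algebraMap (𝓞 K) K ((Algebra.norm ℤ x : ℤ) : 𝓞 K) =
    algebraMap ℚ K (Algebra.norm ℚ (algebraMap (𝓞 K) K x)) := by
    rw [← h2]; simp
  rw [h3, h1]
  rfl

theorem SD.trace_eq (h : SD σ g y w) (x : K) :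
    algebraMap ℚ K (Algebra.trace ℚ K x) = x + σ x + σ (σ x) + σ (σ (σ x)) + σ (σ (σ (σ x)))
      + σ (σ (σ (σ (σ x)))) := by
  have := h.gal
  have h1 := trace_eq_sum_automorphisms (K := ℚ) x
  rw [← h.bij.sum_comp (fun τ => τ x), Fin.sum_univ_six] at h1
  rw [h1]; rfl

theorem SD.conj (h : SD σ g y w) (φ : K →+* ℂ) (x : K) :
    φ (σ (σ (σ x))) = starRingEnd ℂ (φ x) := by
  have := h.gal
  obtain ⟨τ, hτ⟩ := ComplexEmbedding.exists_comp_symm_eq_of_comp_eq (k := ℚ) φ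
    (ComplexEmbedding.conjugate φ) (Subsingleton.elim _ _)
  have hτ' : ∀ x, φ (τ.symm x) = starRingEnd ℂ (φ x) := fun x => by
    have := congrArg (fun f : K →+* ℂ => f x) hτ
    simpa using this
  generalize τ.symm = τ at hτ'
  have hinj := φ.injective
  have h2 : ∀ x, τ (τ x) = x := fun x => hinj (by rw [hτ', hτ']; simp)
  obtain ⟨j, rfl⟩ := Subgroup.mem_zpowers_iff.1 (h.gen τ)
  have h3 : (6 : ℤ) ∣ j + j := by
    rw [← Nat.cast_ofNat, ← h.ord, orderOf_dvd_iff_zpow_eq_one, zpow_add]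
    ext x; exact h2 x
  have hw : (algebraMap (𝓞 K) K w) ^ 2 = algebraMap (𝓞 K) K w - 2 := by
    rw [← map_pow, h.hw, map_sub, map_ofNat]
  have h4 : ¬ (6 : ℤ) ∣ j := by
    intro h5
    rw [← Nat.cast_ofNat, ← h.ord, orderOf_dvd_iff_zpow_eq_one] at h5
    have h6 := hτ' (algebraMap (𝓞 K) K w)
    rw [h5] at h6
    simp only [AlgEquiv.one_apply] at h6
    have h7 := congrArg φ hw
    simp only [map_pow, map_sub, map_ofNat] at h7
    rw [eq_comm, Complex.conj_eq_iff_real] at h6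
    obtain ⟨r, hr⟩ := h6
    rw [hr] at h7
    have h8 : r ^ 2 = r - 2 := by exact_mod_cast h7
    nlinarith [sq_nonneg (2 * r - 1)]
  have h5 : σ ^ j = σ ^ 3 := by
    have h6 : (6 : ℤ) ∣ j - 3 := by omega
    rw [← Nat.cast_ofNat, ← h.ord, orderOf_dvd_iff_zpow_eq_one, zpow_sub, mul_inv_eq_one] at h6
    exact h6
  rw [← hτ', h5]; rfl

theorem SD.g3_norm_nonneg (h : SD σ g y w) (x : 𝓞 K) : 0 ≤ Algebra.norm ℤ x := by
  obtain ⟨φ⟩ : Nonempty (K →+* ℂ) := inferInstance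
  have h1 := h.norm_eq x
  have h2 : ((Algebra.norm ℤ x : ℤ) : ℂ) = φ (algebraMap (𝓞 K) K (Algebra.norm ℤ x : ℤ)) := by simp
  rw [h1] at h2
  simp only [map_mul, h.coe] at h2
  have h3 : ∀ z, φ z * φ (σ (σ (σ z))) = ((Complex.normSq (φ z) : ℝ) : ℂ) := fun z => by
    rw [h.conj, Complex.mul_conj]
  have h4 : ((Algebra.norm ℤ x : ℤ) : ℂ) =
     ((Complex.normSq (φ (algebraMap (𝓞 K) K x)) * Complex.normSq (φ (σ (algebraMap (𝓞 K) K x)))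
      * Complex.normSq (φ (σ (σ (algebraMap (𝓞 K) K x)))) : ℝ) : ℂ) := by
    rw [h2]; push_cast; rw [← h3, ← h3, ← h3]; ring
  rw [← Complex.ofReal_intCast] at h4
  have h5 := Complex.ofReal_injective h4
  have h6 : (0 : ℝ) ≤ ((Algebra.norm ℤ x : ℤ) : ℝ) := by
    rw [h5]
    have := fun z => Complex.normSq_nonneg z
    exact mul_nonneg (mul_nonneg (this _) (this _)) (this _)
  exact_mod_cast h6

theorem SD.absNorm_span (h : SD σ g y w) (x : 𝓞 K) :
    ((Ideal.absNorm (Ideal.span {x}) : ℕ) : 𝓞 K) =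
      x * g x * g (g x) * g (g (g x)) * g (g (g (g x))) * g (g (g (g (g x)))) := by
  rw [← h.norm_eq, Ideal.absNorm_span_singleton, ← Int.cast_natCast,
    Int.natAbs_of_nonneg (h.g3_norm_nonneg x)]

theorem absNorm_map (f : 𝓞 K ≃ₐ[ℤ] 𝓞 K) (I : Ideal (𝓞 K)) :
    Ideal.absNorm (Ideal.map f I) = Ideal.absNorm I := by
  rw [Ideal.absNorm_apply, Ideal.absNorm_apply, Submodule.cardQuot_apply, Submodule.cardQuot_apply]
  exact (Nat.card_congr (Ideal.quotientEquiv I (Ideal.map f I) (f : 𝓞 K ≃+* 𝓞 K) rfl).toEquiv).symm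

theorem map_span (f : 𝓞 K ≃ₐ[ℤ] 𝓞 K) (x : 𝓞 K) :
    Ideal.map f (Ideal.span {x}) = Ideal.span {f x} := by
  rw [Ideal.map_span, Set.image_singleton]

theorem mem_map (f : 𝓞 K ≃ₐ[ℤ] 𝓞 K) (I : Ideal (𝓞 K)) (x : 𝓞 K) :
    f x ∈ Ideal.map f I ↔ x ∈ I := by
  rw [← Ideal.mem_comap, Ideal.comap_map_of_bijective f f.bijective]

theorem map_ne_bot (f : 𝓞 K ≃ₐ[ℤ] 𝓞 K) {I : Ideal (𝓞 K)} (hI : I ≠ ⊥) : Ideal.map f I ≠ ⊥ := by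
  rwa [Ne, Ideal.map_eq_bot_iff_of_injective f.injective]

theorem map_prime (f : 𝓞 K ≃ₐ[ℤ] 𝓞 K) {I : Ideal (𝓞 K)} (hI : I.IsPrime) :
    (Ideal.map f I).IsPrime := Ideal.map_isPrime_of_equiv f

theorem SD.idealConj (h : SD σ g y w) (I : Ideal (𝓞 K)) : idealConj σ I = Ideal.map g I := by
  rw [_root_.idealConj, h.hg]

theorem map_map (f f' : 𝓞 K ≃ₐ[ℤ] 𝓞 K) (I : Ideal (𝓞 K)) :
    Ideal.map f (Ideal.map f' I) = Ideal.map (f * f') I := Ideal.map_map f'.toRingHom f.toRingHom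

theorem SD.idealConj4 (h : SD σ g y w) (I : Ideal (𝓞 K)) : _root_.idealConj (σ ^ 4) I =
    Ideal.map g (Ideal.map g (Ideal.map g (Ideal.map g I))) := by
  rw [_root_.idealConj, map_pow, ← h.hg]
  simp only [map_map]; rfl

theorem SD.idealConj5 (h : SD σ g y w) (I : Ideal (𝓞 K)) : _root_.idealConj (σ ^ 5) I =
    Ideal.map g (Ideal.map g (Ideal.map g (Ideal.map g (Ideal.map g I)))) := by
  rw [_root_.idealConj, map_pow, ← h.hg]
  simp only [map_map]; rfl

end
end Shim

open NumberField
namespace Shim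
section
set_option linter.unusedSectionVars false
variable {K : Type*} [Field K] [NumberField K] {σ : K ≃ₐ[ℚ] K}
    {g : 𝓞 K ≃ₐ[ℤ] 𝓞 K} {y w : 𝓞 K}

theorem SD.gy2 (h : SD σ g y w) : g (g y) = 5 - y - y ^ 2 := by
  rw [h.gy, map_sub, map_pow, h.gy, map_ofNat]
  linear_combination (y + 1) * h.hy

theorem SD.gy3 (h : SD σ g y w) : g (g (g y)) = y := by
  rw [h.gy2, map_sub, map_sub, map_pow, h.gy, map_ofNat]
  linear_combination (-y - 1) * h.hy

theorem SD.gw2 (h : SD σ g y w) : g (g w) = w := by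
  rw [h.gw, map_sub, map_one, h.gw]; ring

theorem SD.trace_int (h : SD σ g y w) (x : 𝓞 K) :
    ((Algebra.trace ℤ (𝓞 K) x : ℤ) : 𝓞 K) = x + g x + g (g x) + g (g (g x)) + g (g (g (g x)))
      + g (g (g (g (g x)))) := by
  apply inj
  have h1 := h.trace_eq (algebraMap (𝓞 K) K x)
  have h2 := Algebra.coe_trace_int x
  simp only [map_add, h.coe]
  rw [← h1, ← h2]; simp

/-- power sums of the conjugates of `y` -/
def pw : ℕ → ℤ
  | 0 => 3
  | 1 => 1
  | 2 => 13
  | (n + 3) => pw (n + 2) + 6 * pw (n + 1) - 7 * pw n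

/-- power sums of the conjugates of `w` -/
def qw : ℕ → ℤ
  | 0 => 2
  | 1 => 1
  | (n + 2) => qw (n + 1) - 2 * qw n

theorem SD.pw_eq (h : SD σ g y w) (a : ℕ) : y ^ a + (g y) ^ a + (g (g y)) ^ a = (pw a : 𝓞 K) := by
  induction a using Nat.strong_induction_on with
  | _ a ih =>
    match a with
    | 0 => simp [pw]; norm_num
    | 1 => rw [h.gy2, h.gy]; simp [pw]; ring
    | 2 => rw [h.gy2, h.gy]; simp [pw]; linear_combination (2 * y + 4) * h.hy
    | (n + 3) =>
      have c1 : (g y) ^ 3 = (g y) ^ 2 + 6 * (g y) - 7 := by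
        rw [← map_pow, h.hy]; simp only [map_sub, map_add, map_mul, map_pow, map_ofNat]
      have c2 : (g (g y)) ^ 3 = (g (g y)) ^ 2 + 6 * (g (g y)) - 7 := by
        rw [← map_pow, c1]; simp only [map_sub, map_add, map_mul, map_pow, map_ofNat]
      have i0 := ih n (by omega)
      have i1 := ih (n + 1) (by omega)
      have i2 := ih (n + 2) (by omega)
      rw [pw]; push_cast
      rw [← i0, ← i1, ← i2]
      linear_combination y ^ n * h.hy + (g y) ^ n * c1 + (g (g y)) ^ n * c2

theorem SD.qw_eq (h : SD σ g y w) (a : ℕ) : w ^ a + (g w) ^ a = (qw a : 𝓞 K) := by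
  induction a using Nat.strong_induction_on with
  | _ a ih =>
    match a with
    | 0 => simp [qw]; norm_num
    | 1 => rw [h.gw]; simp [qw]
    | (n + 2) =>
      have c1 : (g w) ^ 2 = g w - 2 := by
        rw [← map_pow, h.hw]; simp only [map_sub, map_ofNat]
      have i0 := ih n (by omega)
      have i1 := ih (n + 1) (by omega)
      rw [qw]; push_cast
      rw [← i0, ← i1]
      linear_combination w ^ n * h.hw + (g w) ^ n * c1

theorem SD.trace_yw (h : SD σ g y w) (a b : ℕ) :
    Algebra.trace ℤ (𝓞 K) (y ^ a * w ^ b) = pw a * qw b := by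
  have h1 : ((Algebra.trace ℤ (𝓞 K) (y ^ a * w ^ b) : ℤ) : 𝓞 K) = ((pw a * qw b : ℤ) : 𝓞 K) := by
    rw [h.trace_int]; push_cast; rw [← h.pw_eq, ← h.qw_eq]
    simp only [map_mul, map_pow, h.gy3, h.gw2]
    ring
  exact_mod_cast h1

theorem SD.discr_le (h : SD σ g y w) : |discr K| ≤ 44700103 := by
  let e : Fin 3 × Fin 2 → 𝓞 K := fun i => y ^ (i.1 : ℕ) * w ^ (i.2 : ℕ)
  have hc : Fintype.card (Module.Free.ChooseBasisIndex ℤ (𝓞 K)) = Fintype.card (Fin 3 × Fin 2) := by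
    rw [← Module.finrank_eq_card_chooseBasisIndex, RingOfIntegers.rank, h.fr]; rfl
  let b := (RingOfIntegers.basis K).reindex (Fintype.equivOfCardEq hc)
  have h1 : Algebra.discr ℤ e = (b.toMatrix e).det ^ 2 * discr K := by
    rw [← discr_eq_discr K b, ← Algebra.discr_of_matrix_vecMul, Module.Basis.toMatrix_map_vecMul]
  have h2 : Algebra.discr ℤ e = -44700103 := by
    rw [Algebra.discr_def]
    have h3 : Algebra.traceMatrix ℤ e = Matrix.kroneckerMap (· * ·)
      (Matrix.of fun i k : Fin 3 => pw (i + k)) (Matrix.of fun i k : Fin 2 => qw (i + k)) := by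
      ext i j
      rw [Algebra.traceMatrix_apply, Algebra.traceForm_apply, Matrix.kroneckerMap_apply]
      simp only [e, Matrix.of_apply]
      rw [← h.trace_yw]
      congr 1; ring
    rw [h3, Matrix.det_kronecker, Matrix.det_fin_three, Matrix.det_fin_two]
    simp [pw, qw]
  rw [h2] at h1
  have h4 : (b.toMatrix e).det ≠ 0 := by
    intro h5; rw [h5] at h1; norm_num at h1
  have h6 : 1 ≤ (b.toMatrix e).det ^ 2 := by
    have := pow_pos (abs_pos.2 h4) 2
    rw [sq_abs] at this; exact this
  have h7 := congrArg abs h1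
  rw [abs_mul, abs_of_nonneg (by positivity : 0 ≤ (b.toMatrix e).det ^ 2)] at h7
  norm_num at h7
  nlinarith [abs_nonneg (discr K)]

open Ideal in
theorem SD.minkowski (h : SD σ g y w) (C : ClassGroup (𝓞 K)) :
    ∃ I : (nonZeroDivisors (Ideal (𝓞 K))), ClassGroup.mk0 I = C ∧
      absNorm (I : Ideal (𝓞 K)) ≤ 213 := by
  obtain ⟨I, hI, hn⟩ := exists_ideal_in_class_of_norm_le C
  refine ⟨I, hI, ?_⟩
  have hr : InfinitePlace.nrComplexPlaces K ≤ 3 := by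
    have := InfinitePlace.card_add_two_mul_card_eq_rank K
    rw [h.fr] at this; omega
  have hd : Real.sqrt |(discr K : ℝ)| ≤ 6686 := by
    rw [Real.sqrt_le_left (by norm_num)]
    have : ((|discr K| : ℤ) : ℝ) ≤ 44700103 := by exact_mod_cast h.discr_le
    rw [Int.cast_abs] at this
    linarith
  have hp : (4 / Real.pi) ^ InfinitePlace.nrComplexPlaces K ≤ (2.0644 : ℝ) := by
    have hpi : (4 / Real.pi : ℝ) ≤ 1.27328 := by
      rw [div_le_iff₀ Real.pi_pos]
      have := Real.pi_gt_d4
      linarith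
    have h1 : (1 : ℝ) ≤ 4 / Real.pi := by
      rw [le_div_iff₀ Real.pi_pos]; linarith [Real.pi_le_four]
    calc (4 / Real.pi) ^ InfinitePlace.nrComplexPlaces K ≤ (4 / Real.pi) ^ 3 := pow_le_pow_right₀ h1 hr
      _ ≤ 1.27328 ^ 3 := by gcongr
      _ ≤ 2.0644 := by norm_num
  rw [h.fr] at hn
  have h3 : (absNorm (I : Ideal (𝓞 K)) : ℝ) < 214 := by
    refine lt_of_le_of_lt hn ?_
    have h4 : ((Nat.factorial 6 : ℕ) : ℝ) / ((6 : ℕ) : ℝ) ^ 6 * Real.sqrt |(discr K : ℝ)| ≤ 103.2 := by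
      have : ((Nat.factorial 6 : ℕ) : ℝ) / ((6 : ℕ) : ℝ) ^ 6 = 720 / 46656 := by
        simp [Nat.factorial]; norm_num
      rw [this]
      linarith
    calc _ ≤ (2.0644 : ℝ) * 103.2 := by
            first
            | exact mul_le_mul hp h4 (by positivity) (by norm_num)
            | (rw [mul_assoc]; exact mul_le_mul hp h4 (by positivity) (by norm_num))
      _ < 214 := by norm_num
  have : absNorm (I : Ideal (𝓞 K)) < 214 := by exact_mod_cast h3
  omega

end
end Shim

open NumberField
namespace Shim
section
set_option linter.unusedSectionVars false
variable {K : Type*} [Field K] [NumberField K] {σ : K ≃ₐ[ℚ] K}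
    {g : 𝓞 K ≃ₐ[ℤ] 𝓞 K} {y w : 𝓞 K}

/-- the type norm on ideals -/
noncomputable def Phi (g : 𝓞 K ≃ₐ[ℤ] 𝓞 K) (I : Ideal (𝓞 K)) : Ideal (𝓞 K) :=
  I * Ideal.map g (Ideal.map g (Ideal.map g (Ideal.map g I))) *
    Ideal.map g (Ideal.map g (Ideal.map g (Ideal.map g (Ideal.map g I))))

/-- the type norm on elements -/
noncomputable def phi (g : 𝓞 K ≃ₐ[ℤ] 𝓞 K) (x : 𝓞 K) : 𝓞 K :=
  x * g (g (g (g x))) * g (g (g (g (g x))))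

/-- `γ` is a generator of the type norm of `I` with the right absolute values -/
def IsGen (g : 𝓞 K ≃ₐ[ℤ] 𝓞 K) (I : Ideal (𝓞 K)) (γ : 𝓞 K) : Prop :=
  Ideal.span {γ} = Phi g I ∧ γ * g (g (g γ)) = ((Ideal.absNorm I : ℕ) : 𝓞 K)

theorem Phi_mul (I J : Ideal (𝓞 K)) : Phi g (I * J) = Phi g I * Phi g J := by
  simp only [Phi, Ideal.map_mul]; ring

theorem Phi_span (x : 𝓞 K) : Phi g (Ideal.span {x}) = Ideal.span {phi g x} := by
  simp only [Phi, map_span, Ideal.span_singleton_mul_span_singleton, phi]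

theorem Phi_ne_bot {I : Ideal (𝓞 K)} (hI : I ≠ ⊥) : Phi g I ≠ ⊥ := by
  have h4 := map_ne_bot g (map_ne_bot g (map_ne_bot g (map_ne_bot g hI)))
  exact mul_ne_zero (mul_ne_zero hI h4) (map_ne_bot g h4)

theorem phi_ne_zero {x : 𝓞 K} (hx : x ≠ 0) : phi g x ≠ 0 := by
  simp [phi, hx]

theorem phi_mul (x z : 𝓞 K) : phi g (x * z) = phi g x * phi g z := by
  simp only [phi, map_mul]; ring

theorem SD.phi_conj (h : SD σ g y w) (x : 𝓞 K) :
    phi g x * g (g (g (phi g x))) = ((Ideal.absNorm (Ideal.span {x}) : ℕ) : 𝓞 K) := by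
  rw [h.absNorm_span]
  simp only [phi, map_mul, h.g6]; ring

theorem IsGen.mul {I J : Ideal (𝓞 K)} {γ δ : 𝓞 K} (h1 : IsGen g I γ) (h2 : IsGen g J δ) :
    IsGen g (I * J) (γ * δ) := by
  refine ⟨?_, ?_⟩
  · rw [Phi_mul, ← h1.1, ← h2.1, Ideal.span_singleton_mul_span_singleton]
  · rw [map_mul Ideal.absNorm]; push_cast; rw [← h1.2, ← h2.2]; simp only [map_mul]; ring

theorem SD.gen_span (h : SD σ g y w) (x : 𝓞 K) : IsGen g (Ideal.span {x}) (phi g x) :=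
  ⟨(Phi_span x).symm, h.phi_conj x⟩

theorem SD.good_of_class (h : SD σ g y w) {I J : Ideal (𝓞 K)} {a b : 𝓞 K} (ha : a ≠ 0)
    (hab : Ideal.span {a} * I = Ideal.span {b} * J) (hJ : ∃ γ, IsGen g J γ) :
    ∃ γ, IsGen g I γ := by
  obtain ⟨δ, hδ⟩ := hJ
  have h1 : Ideal.span {phi g a} * Phi g I = Ideal.span {phi g b * δ} := by
    rw [← Phi_span, ← Phi_mul, hab, Phi_mul, Phi_span, ← hδ.1,
      Ideal.span_singleton_mul_span_singleton]
  have hpa := phi_ne_zero (g := g) ha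
  have h2 : phi g a ∣ phi g b * δ := by
    have h0 : Ideal.span {phi g a} ∣ Ideal.span {phi g b * δ} := ⟨_, h1.symm⟩
    rw [Ideal.dvd_span_singleton] at h0
    exact Ideal.mem_span_singleton.1 h0
  obtain ⟨γ, hγ⟩ := h2
  have h3 : Ideal.span {γ} = Phi g I := by
    rw [hγ, ← Ideal.span_singleton_mul_span_singleton] at h1
    exact (Ideal.span_singleton_mul_right_inj hpa).1 h1.symm
  refine ⟨γ, h3, ?_⟩
  have h4 := congrArg Ideal.absNorm hab
  rw [map_mul, map_mul] at h4
  have h4' := congrArg (fun n : ℕ => (n : 𝓞 K)) h4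
  simp only [Nat.cast_mul] at h4'
  rw [← h.phi_conj, ← h.phi_conj, ← hδ.2] at h4'
  have h5 : phi g a * g (g (g (phi g a))) ≠ 0 := mul_ne_zero hpa (by simpa using hpa)
  apply mul_left_cancel₀ h5
  rw [h4']
  have h6 := congrArg (fun z => z * g (g (g z))) hγ
  simp only [map_mul] at h6
  linear_combination -h6

theorem SD.all_gen (h : SD σ g y w)
    (hP : ∀ P : Ideal (𝓞 K), P.IsPrime → P ≠ ⊥ → Ideal.absNorm P ≤ 213 → ∃ γ, IsGen g P γ)
    (I : Ideal (𝓞 K)) (hI : I ≠ ⊥) : ∃ γ, IsGen g I γ := by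
  have small : ∀ J : Ideal (𝓞 K), Ideal.absNorm J ≤ 213 → J ≠ ⊥ → ∃ γ, IsGen g J γ := by
    intro J
    induction J using UniqueFactorizationMonoid.induction_on_prime with
    | h₁ => intro _ h0; exact absurd rfl h0
    | h₂ x hx =>
      intro _ _
      rw [Ideal.isUnit_iff] at hx
      refine ⟨phi g 1, ?_⟩
      rw [hx, ← Ideal.span_singleton_one]; exact h.gen_span 1
    | h₃ J P hJ hPp ih =>
      intro hn _
      rw [map_mul] at hn
      have hJ1 : 0 < Ideal.absNorm J := Nat.pos_of_ne_zero (by rwa [Ne, Ideal.absNorm_eq_zero_iff])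
      have hP1 : 0 < Ideal.absNorm P :=
        Nat.pos_of_ne_zero (by rw [Ne, Ideal.absNorm_eq_zero_iff]; exact hPp.ne_zero)
      obtain ⟨γ, hγ⟩ := hP P (Ideal.isPrime_of_prime hPp) hPp.ne_zero
        ((Nat.le_mul_of_pos_right _ hJ1).trans hn)
      obtain ⟨δ, hδ⟩ := ih ((Nat.le_mul_of_pos_left _ hP1).trans hn) hJ
      exact ⟨_, hγ.mul hδ⟩
  obtain ⟨J, hJ, hn⟩ := h.minkowski (ClassGroup.mk0 ⟨I, mem_nonZeroDivisors_of_ne_zero hI⟩)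
  rw [ClassGroup.mk0_eq_mk0_iff] at hJ
  obtain ⟨b, a, hb, ha, hab⟩ := hJ
  exact h.good_of_class ha hab.symm (small J hn (nonZeroDivisors.coe_ne_zero J))

theorem SD.gen_prime (h : SD σ g y w) {P : Ideal (𝓞 K)} (hP : P.IsPrime) (hP0 : P ≠ ⊥) {p : ℕ}
    (hp : p.Prime) (hp19 : p ≠ 19) (hpP : (p : 𝓞 K) ∈ P) {a : ℤ} (ha : y - (a : 𝓞 K) ∈ P)
    {γ : 𝓞 K} (hγ : γ * g (g (g γ)) = p) (h0 : γ ∈ P) (h1 : g γ ∈ P) (h2 : g (g γ) ∈ P) :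
    IsGen g P γ ∧ Ideal.absNorm P = p := by
  set P4 := Ideal.map g (Ideal.map g (Ideal.map g (Ideal.map g P))) with hP4
  set P5 := Ideal.map g (Ideal.map g (Ideal.map g (Ideal.map g (Ideal.map g P)))) with hP5
  have mem4 : ∀ x, x ∈ P → g (g (g (g x))) ∈ P4 := fun x hx => by
    simp only [hP4, mem_map]; exact hx
  have mem5 : ∀ x, x ∈ P → g (g (g (g (g x)))) ∈ P5 := fun x hx => by
    simp only [hP5, mem_map]; exact hx
  have hP4p : P4.IsPrime := map_prime g (map_prime g (map_prime g (map_prime g hP)))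
  have hP5p : P5.IsPrime := map_prime g hP4p
  have hP40 : P4 ≠ ⊥ := map_ne_bot g (map_ne_bot g (map_ne_bot g (map_ne_bot g hP0)))
  have hP50 : P5 ≠ ⊥ := map_ne_bot g hP40
  have m : ∀ {Q : Ideal (𝓞 K)}, Q.IsPrime → Q ≠ ⊥ → Q.IsMaximal := fun hq hq0 => hq.isMaximal hq0
  have p4 : (p : 𝓞 K) ∈ P4 := by simpa using mem4 _ hpP
  have p5 : (p : 𝓞 K) ∈ P5 := by simpa using mem5 _ hpP
  have a4 : (y ^ 2 - 4) - (a : 𝓞 K) ∈ P4 := by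
    have := mem4 _ ha
    simp only [map_sub, map_intCast, h.gy3] at this
    rwa [h.gy] at this
  have a5 : (5 - y - y ^ 2) - (a : 𝓞 K) ∈ P5 := by
    have := mem5 _ ha
    simp only [map_sub, map_intCast, h.gy3] at this
    rwa [h.gy2] at this
  have no19 : ∀ {Q : Ideal (𝓞 K)}, Q.IsPrime → (p : 𝓞 K) ∈ Q → (19 : 𝓞 K) ∉ Q := by
    intro Q hQ hq h19
    apply hQ.ne_top
    rw [Ideal.eq_top_iff_one]
    have hc : IsCoprime (p : ℤ) (19 : ℤ) := by
      rw [show (19 : ℤ) = ((19 : ℕ) : ℤ) by rfl, Nat.isCoprime_iff_coprime]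
      exact (Nat.coprime_primes hp (by norm_num)).2 hp19
    obtain ⟨u, v, huv⟩ := hc
    have huv' : (u : 𝓞 K) * (p : 𝓞 K) + (v : 𝓞 K) * 19 = 1 := by exact_mod_cast congrArg (Int.cast (R := 𝓞 K)) huv
    rw [← huv']
    exact Q.add_mem (Q.mul_mem_left _ hq) (Q.mul_mem_left _ h19)
  have key : (y ^ 2 - 4 - y) * ((y ^ 2 - 4) - (5 - y - y ^ 2)) * (5 - y - y ^ 2 - y) = 19 := by
    linear_combination (-2 * y ^ 3 - 5 * y ^ 2 + 13 * y + 23) * h.hy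
  have d4 : P ≠ P4 := by
    intro e; rw [← e] at a4
    apply no19 hP hpP
    rw [← key]
    refine P.mul_mem_right _ (P.mul_mem_right _ ?_)
    convert P.sub_mem a4 ha using 1; ring
  have d5 : P ≠ P5 := by
    intro e; rw [← e] at a5
    apply no19 hP hpP
    rw [← key]
    refine P.mul_mem_left _ ?_
    convert P.sub_mem a5 ha using 1; ring
  have d45 : P4 ≠ P5 := by
    intro e; rw [← e] at a5
    apply no19 hP4p p4
    rw [← key]
    refine P4.mul_mem_right _ (P4.mul_mem_left _ ?_)
    convert P4.sub_mem a4 a5 using 1; ring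
  have c4 : IsCoprime P P4 := by
    have := m hP hP0; have := m hP4p hP40
    exact Ideal.isCoprime_iff_sup_eq.2 (Ideal.IsMaximal.coprime_of_ne ‹_› ‹_› d4)
  have c5 : IsCoprime P P5 :=
    Ideal.isCoprime_iff_sup_eq.2 (Ideal.IsMaximal.coprime_of_ne (m hP hP0) (m hP5p hP50) d5)
  have c45 : IsCoprime P4 P5 :=
    Ideal.isCoprime_iff_sup_eq.2 (Ideal.IsMaximal.coprime_of_ne (m hP4p hP40) (m hP5p hP50) d45)
  have g4 : γ ∈ P4 := by
    have := mem4 _ h2; rwa [h.g6] at this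
  have g5 : γ ∈ P5 := by
    have := mem5 _ h1; rwa [h.g6] at this
  have dv : Phi g P ∣ Ideal.span {γ} := by
    refine IsCoprime.mul_dvd (IsCoprime.mul_left c5 c45) (IsCoprime.mul_dvd c4 ?_ ?_) ?_
    all_goals rw [Ideal.dvd_span_singleton]; assumption
  have nγ : Ideal.absNorm (Ideal.span {γ}) = p ^ 3 := by
    have e1 := h.absNorm_span γ
    have e2 := congrArg g hγ
    have e3 := congrArg g e2
    simp only [map_mul, map_natCast] at e2 e3
    have : ((Ideal.absNorm (Ideal.span {γ}) : ℕ) : 𝓞 K) = ((p ^ 3 : ℕ) : 𝓞 K) := by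
      rw [e1]; push_cast
      calc _ = (γ * g (g (g γ))) * (g γ * g (g (g (g γ)))) * (g (g γ) * g (g (g (g (g γ))))) := by ring
        _ = _ := by rw [hγ, e2, e3]; ring
    exact_mod_cast this
  have nPhi : Ideal.absNorm (Phi g P) = Ideal.absNorm P ^ 3 := by
    simp only [Phi, map_mul, absNorm_map]; ring
  obtain ⟨J, hJ⟩ := dv
  have e := congrArg Ideal.absNorm hJ
  rw [map_mul, nγ, nPhi] at e
  have e1 : Ideal.absNorm P = p := by
    have : Ideal.absNorm P ∣ p := (Nat.pow_dvd_pow_iff (by norm_num : 3 ≠ 0)).1 ⟨_, e⟩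
    rcases (Nat.dvd_prime hp).1 this with h' | h'
    · exact absurd (Ideal.absNorm_eq_one_iff.1 h') hP.ne_top
    · exact h'
  have e2 : Ideal.absNorm J = 1 := by
    rw [e1] at e
    exact (Nat.eq_of_mul_eq_mul_left (pow_pos hp.pos 3) (by rw [mul_one]; exact e)).symm
  rw [Ideal.absNorm_eq_one_iff] at e2
  rw [e2, Ideal.mul_top] at hJ
  exact ⟨⟨hJ, by rw [e1, hγ]⟩, e1⟩
end
end Shim

open NumberField
namespace Shim
section
set_option linter.unusedSectionVars false
variable {K : Type*} [Field K] [NumberField K] {σ : K ≃ₐ[ℚ] K}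
    {g : 𝓞 K ≃ₐ[ℤ] 𝓞 K} {y w : 𝓞 K}

/-- evaluation of an explicit element -/
def ev {R : Type*} [CommRing R] (c : Fin 6 → ℤ) (a b : R) : R :=
  c 0 + c 1 * a + c 2 * a ^ 2 + (c 3 + c 4 * a + c 5 * a ^ 2) * b

theorem ev_map {R S : Type*} [CommRing R] [CommRing S] (f : R →+* S) (c : Fin 6 → ℤ) (a b : R) :
    f (ev c a b) = ev c (f a) (f b) := by
  simp [ev]

/-- the action on `y` -/
def ty {R : Type*} [CommRing R] (a : R) : ℕ → R
  | 0 => a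
  | n + 1 => (ty a n) ^ 2 - 4

/-- the action on `w` -/
def tw {R : Type*} [CommRing R] (a : R) : ℕ → R
  | 0 => a
  | n + 1 => 1 - tw a n

theorem ty_map {R S : Type*} [CommRing R] [CommRing S] (f : R →+* S) (a : R) (n : ℕ) :
    f (ty a n) = ty (f a) n := by
  induction n with
  | zero => rfl
  | succ n ih => rw [ty, ty, map_sub, map_pow, ih, map_ofNat]

theorem tw_map {R S : Type*} [CommRing R] [CommRing S] (f : R →+* S) (a : R) (n : ℕ) :
    f (tw a n) = tw (f a) n := by
  induction n with
  | zero => rfl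
  | succ n ih => simp [tw, ih]

theorem ty_succ {R : Type*} [CommRing R] (a : R) (n : ℕ) : ty a (n + 1) = ty (a ^ 2 - 4) n := by
  induction n with
  | zero => rfl
  | succ n ih => rw [ty, ih]; rfl

theorem tw_succ {R : Type*} [CommRing R] (a : R) (n : ℕ) : tw a (n + 1) = tw (1 - a) n := by
  induction n with
  | zero => rfl
  | succ n ih => rw [tw, ih]; rfl

theorem SD.g_ev (h : SD σ g y w) (c : Fin 6 → ℤ) (n : ℕ) :
    g (ev c (ty y n) (tw w n)) = ev c (ty y (n + 1)) (tw w (n + 1)) := by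
  have h1 := ev_map (g : 𝓞 K →+* 𝓞 K) c (ty y n) (tw w n)
  have h2 := ty_map (g : 𝓞 K →+* 𝓞 K) y n
  have h3 := tw_map (g : 𝓞 K →+* 𝓞 K) w n
  rw [h2, h3] at h1
  rw [ty_succ, tw_succ, ← h.gy, ← h.gw]
  exact h1

theorem SD.gen_data (h : SD σ g y w) {P : Ideal (𝓞 K)} (hP : P.IsPrime) (hP0 : P ≠ ⊥) {p : ℕ}
    (hp : p.Prime) (hp19 : p ≠ 19) (hpP : (p : 𝓞 K) ∈ P) (c : Fin 6 → ℤ)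
    (hc : ev c y w * ev c y (1 - w) = p) (r : Fin 3 → ZMod p) (s : Fin 2 → ZMod p)
    (hr : r 0 + r 1 + r 2 = 1 ∧ r 0 * r 1 + r 0 * r 2 + r 1 * r 2 = -6 ∧ r 0 * r 1 * r 2 = -7)
    (hs : s 0 + s 1 = 1 ∧ s 0 * s 1 = 2)
    (hd : ∀ i k, ∃ j : Fin 6, ∀ l : Fin 3, ev c (ty (r i) (j + l)) (tw (s k) (j + l)) = 0) :
    ∃ γ, IsGen g P γ ∧ Ideal.absNorm P = p := by
  have : Fact p.Prime := ⟨hp⟩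
  have hch : CharP (𝓞 K ⧸ P) p := by
    rw [CharP.charP_iff_prime_eq_zero hp]
    have := Ideal.Quotient.eq_zero_iff_mem.2 hpP
    simpa using this
  let q := Ideal.Quotient.mk P
  let f : ZMod p →+* 𝓞 K ⧸ P := ZMod.castHom dvd_rfl _
  have hy : ∃ i, q y = f (r i) := by
    have h1 : (q y - f (r 0)) * ((q y - f (r 1)) * (q y - f (r 2))) = 0 := by
      have e := congrArg q h.hy
      have e1 := congrArg f hr.1
      have e2 := congrArg f hr.2.1
      have e3 := congrArg f hr.2.2
      simp only [map_add, map_sub, map_mul, map_pow, map_one, map_neg, map_ofNat] at e e1 e2 e3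
      linear_combination e - (q y) ^ 2 * e1 + q y * e2 - e3
    rcases mul_eq_zero.1 h1 with h2 | h2
    · exact ⟨0, sub_eq_zero.1 h2⟩
    rcases mul_eq_zero.1 h2 with h2 | h2
    · exact ⟨1, sub_eq_zero.1 h2⟩
    · exact ⟨2, sub_eq_zero.1 h2⟩
  have hw : ∃ i, q w = f (s i) := by
    have h1 : (q w - f (s 0)) * (q w - f (s 1)) = 0 := by
      have e := congrArg q h.hw
      have e1 := congrArg f hs.1
      have e2 := congrArg f hs.2
      simp only [map_add, map_sub, map_mul, map_pow, map_one, map_ofNat] at e e1 e2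
      linear_combination e - (q w) * e1 + e2
    rcases mul_eq_zero.1 h1 with h2 | h2
    · exact ⟨0, sub_eq_zero.1 h2⟩
    · exact ⟨1, sub_eq_zero.1 h2⟩
  obtain ⟨i, hi⟩ := hy
  obtain ⟨k, hk⟩ := hw
  obtain ⟨j, hj⟩ := hd i k
  have mem : ∀ l : Fin 3, ev c (ty y (j + l)) (tw w (j + l)) ∈ P := by
    intro l
    rw [← Ideal.Quotient.eq_zero_iff_mem]
    change q _ = 0
    rw [ev_map, ty_map, tw_map, hi, hk, ← ty_map, ← tw_map, ← ev_map, hj l, map_zero]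
  have ha : ∃ a : ℤ, y - (a : 𝓞 K) ∈ P := by
    obtain ⟨a, ha⟩ := ZMod.intCast_surjective (r i)
    refine ⟨a, ?_⟩
    rw [← Ideal.Quotient.eq_zero_iff_mem, map_sub]
    change q y - q a = 0
    rw [hi, ← ha]; simp
  obtain ⟨a, ha⟩ := ha
  have hgg : ∀ n, ev c (ty y n) (tw w n) * g (g (g (ev c (ty y n) (tw w n)))) = p := by
    intro n
    induction n with
    | zero =>
      have h3 : g (g (g (ev c (ty y 0) (tw w 0)))) = ev c y (1 - w) := by
        rw [h.g_ev, h.g_ev, h.g_ev]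
        have e1 : ty y (0 + 1 + 1 + 1) = y := by
          have h4 := h.gy3
          simp only [h.gy, map_sub, map_pow, map_ofNat] at h4
          exact h4
        have e2 : tw w (0 + 1 + 1 + 1) = 1 - w := by simp [tw]
        rw [e1, e2]
      rw [h3]; exact hc
    | succ n ih =>
      rw [← h.g_ev, ← map_mul, ih, map_natCast]
  have m0 := mem 0
  have m1 := mem 1
  have m2 := mem 2
  exact ⟨_, h.gen_prime hP hP0 hp hp19 hpP ha (hgg j) m0 (by rw [h.g_ev]; exact m1)
    (by rw [h.g_ev, h.g_ev]; exact m2)⟩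

theorem SD.gen_list (h : SD σ g y w) {P : Ideal (𝓞 K)} (hP : P.IsPrime) (hP0 : P ≠ ⊥) {p : ℕ}
    (hpl : p ∈ [7, 11, 37, 107, 113, 151, 163, 179, 191, 197]) (hpP : (p : 𝓞 K) ∈ P) :
    ∃ γ, IsGen g P γ ∧ Ideal.absNorm P = p := by
  have hy := h.hy
  have hw := h.hw
  simp only [List.mem_cons, List.not_mem_nil, or_false] at hpl
  rcases hpl with rfl | rfl | rfl | rfl | rfl | rfl | rfl | rfl | rfl | rfl
  · refine h.gen_data hP hP0 (by norm_num) (by norm_num) hpP ![-1, 0, 0, 2, 0, 0] ?_ ![0, 3, 5] ![4, 4]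
      (by decide +kernel) (by decide +kernel) (by decide +kernel)
    simp [ev]
    linear_combination ((0) + (0) * y) * hy - (2 + 0 * y + 0 * y ^ 2) ^ 2 * hw
  · refine h.gen_data hP hP0 (by norm_num) (by norm_num) hpP ![0, -1, 0, 4, 0, -1] ?_ ![5, 8, 10] ![5, 7]
      (by decide +kernel) (by decide +kernel) (by decide +kernel)
    simp [ev]
    linear_combination ((3) + (2) * y) * hy - (4 + 0 * y - 1 * y ^ 2) ^ 2 * hw
  · refine h.gen_data hP hP0 (by norm_num) (by norm_num) hpP ![-3, -1, 1, -2, -1, 0] ?_ ![7, 8, 23] ![9, 29]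
      (by decide +kernel) (by decide +kernel) (by decide +kernel)
    simp [ev]
    linear_combination ((-2) + (1) * y) * hy - (-2 - 1 * y + 0 * y ^ 2) ^ 2 * hw
  · refine h.gen_data hP hP0 (by norm_num) (by norm_num) hpP ![-7, -3, 1, -6, 1, 2] ?_ ![40, 77, 98] ![49, 59]
      (by decide +kernel) (by decide +kernel) (by decide +kernel)
    simp [ev]
    linear_combination ((8) + (11) * y) * hy - (-6 + 1 * y + 2 * y ^ 2) ^ 2 * hw
  · refine h.gen_data hP hP0 (by norm_num) (by norm_num) hpP ![9, 1, 0, 1, 1, -1] ?_ ![21, 98, 108] ![43, 71]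
      (by decide +kernel) (by decide +kernel) (by decide +kernel)
    simp [ev]
    linear_combination ((-3) + (2) * y) * hy - (1 + 1 * y - 1 * y ^ 2) ^ 2 * hw
  · refine h.gen_data hP hP0 (by norm_num) (by norm_num) hpP ![-3, -1, 0, -5, -3, 1] ?_ ![6, 32, 114] ![70, 82]
      (by decide +kernel) (by decide +kernel) (by decide +kernel)
    simp [ev]
    linear_combination ((-11) + (2) * y) * hy - (-5 - 3 * y + 1 * y ^ 2) ^ 2 * hw
  · refine h.gen_data hP hP0 (by norm_num) (by norm_num) hpP ![-6, 1, 3, -8, -2, 1] ?_ ![36, 140, 151] ![26, 138]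
      (by decide +kernel) (by decide +kernel) (by decide +kernel)
    simp [ev]
    linear_combination ((7) + (14) * y) * hy - (-8 - 2 * y + 1 * y ^ 2) ^ 2 * hw
  · refine h.gen_data hP hP0 (by norm_num) (by norm_num) hpP ![2, -2, 1, 7, 3, -1] ?_ ![25, 71, 84] ![54, 126]
      (by decide +kernel) (by decide +kernel) (by decide +kernel)
    simp [ev]
    linear_combination ((-9) + (2) * y) * hy - (7 + 3 * y - 1 * y ^ 2) ^ 2 * hw
  · refine h.gen_data hP hP0 (by norm_num) (by norm_num) hpP ![-8, 3, 2, -6, -4, 1] ?_ ![35, 75, 82] ![20, 172]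
      (by decide +kernel) (by decide +kernel) (by decide +kernel)
    simp [ev]
    linear_combination ((-1) + (8) * y) * hy - (-6 - 4 * y + 1 * y ^ 2) ^ 2 * hw
  · refine h.gen_data hP hP0 (by norm_num) (by norm_num) hpP ![-13, 0, 2, 0, -4, 0] ?_ ![92, 117, 186] ![53, 145]
      (by decide +kernel) (by decide +kernel) (by decide +kernel)
    simp [ev]
    linear_combination ((-4) + (4) * y) * hy - (0 - 4 * y + 0 * y ^ 2) ^ 2 * hw
end
end Shim

open NumberField
namespace Shim
section
set_option linter.unusedSectionVars false

theorem three_dvd {k : Type*} [Field k] {p : ℕ} [Fact p.Prime] [Algebra (ZMod p) k] [Finite k]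
    {x : k} (hx : x ^ 3 = x ^ 2 + 6 * x - 7) (hn : ∀ a : ZMod p, a ^ 3 + 7 ≠ a ^ 2 + 6 * a) :
    3 ∣ Module.finrank (ZMod p) k := by
  open Polynomial in
  let q : Polynomial (ZMod p) := X ^ 3 - (X ^ 2 + 6 * X - 7)
  have hdl : (Polynomial.X ^ 2 + 6 * Polynomial.X - 7 : Polynomial (ZMod p)).degree < (3 : ℕ) := by
    refine lt_of_le_of_lt (b := ((2 : ℕ) : WithBot ℕ)) ?_ (by exact_mod_cast (by norm_num : 2 < 3))
    compute_degree
    exact le_rfl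
  have hm : q.Monic := Polynomial.monic_X_pow_sub (n := 3) (by simpa using hdl)
  have hd : q.natDegree = 3 := by
    apply Polynomial.natDegree_eq_of_degree_eq_some
    rw [Polynomial.degree_sub_eq_left_of_degree_lt] <;> rw [Polynomial.degree_X_pow]
    exact hdl
  have hi : Irreducible q := by
    rw [Polynomial.Monic.irreducible_iff_roots_eq_zero_of_degree_le_three hm (by omega) (by omega)]
    rw [Multiset.eq_zero_iff_forall_notMem]
    intro a ha
    have := Polynomial.isRoot_of_mem_roots ha
    simp only [q, Polynomial.IsRoot.def, Polynomial.eval_sub, Polynomial.eval_add,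
      Polynomial.eval_mul, Polynomial.eval_pow, Polynomial.eval_X, Polynomial.eval_ofNat] at this
    apply hn a
    linear_combination this
  have hx' : Polynomial.aeval x q = 0 := by
    simp only [q, map_sub, map_add, map_mul, map_pow, Polynomial.aeval_X, map_ofNat]
    linear_combination hx
  have := minpoly.eq_of_irreducible_of_monic hi hx' hm
  have h2 := minpoly.degree_dvd (K := ZMod p) (x := x) (Algebra.IsIntegral.isIntegral x)
  rwa [← this, hd] at h2

theorem two_dvd {k : Type*} [Field k] {p : ℕ} [Fact p.Prime] [Algebra (ZMod p) k] [Finite k]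
    {x : k} (hx : x ^ 2 = x - 2) (hn : ∀ a : ZMod p, a ^ 2 + 2 ≠ a) :
    2 ∣ Module.finrank (ZMod p) k := by
  open Polynomial in
  let q : Polynomial (ZMod p) := X ^ 2 - (X - 2)
  have hdl : (Polynomial.X - 2 : Polynomial (ZMod p)).degree < (2 : ℕ) := by
    refine lt_of_le_of_lt (b := ((1 : ℕ) : WithBot ℕ)) ?_ (by exact_mod_cast (by norm_num : 1 < 2))
    compute_degree
    exact le_rfl
  have hm : q.Monic := Polynomial.monic_X_pow_sub (n := 2) (by simpa using hdl)
  have hd : q.natDegree = 2 := by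
    apply Polynomial.natDegree_eq_of_degree_eq_some
    rw [Polynomial.degree_sub_eq_left_of_degree_lt] <;> rw [Polynomial.degree_X_pow]
    exact hdl
  have hi : Irreducible q := by
    rw [Polynomial.Monic.irreducible_iff_roots_eq_zero_of_degree_le_three hm (by omega) (by omega)]
    rw [Multiset.eq_zero_iff_forall_notMem]
    intro a ha
    have := Polynomial.isRoot_of_mem_roots ha
    simp only [q, Polynomial.IsRoot.def, Polynomial.eval_sub, 
      Polynomial.eval_pow, Polynomial.eval_X, Polynomial.eval_ofNat] at this
    apply hn a
    linear_combination this
  have hx' : Polynomial.aeval x q = 0 := by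
    simp only [q, map_sub, map_pow, Polynomial.aeval_X, map_ofNat]
    linear_combination hx
  have := minpoly.eq_of_irreducible_of_monic hi hx' hm
  have h2 := minpoly.degree_dvd (K := ZMod p) (x := x) (Algebra.IsIntegral.isIntegral x)
  rwa [← this, hd] at h2

/-- no root of the cubic modulo `p` -/
def noC (p : ℕ) : Prop := ∀ a < p, (a ^ 3 + 7) % p ≠ (a ^ 2 + 6 * a) % p
/-- no root of the quadratic modulo `p` -/
def noQ (p : ℕ) : Prop := ∀ a < p, (a ^ 2 + 2) % p ≠ a % p

instance : DecidablePred noC := fun p => by unfold noC; infer_instance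
instance : DecidablePred noQ := fun p => by unfold noQ; infer_instance

theorem noC_zmod {p : ℕ} [Fact p.Prime] (h : noC p) (a : ZMod p) : a ^ 3 + 7 ≠ a ^ 2 + 6 * a := by
  intro e
  apply h a.val (ZMod.val_lt a)
  rw [← Nat.ModEq, ← ZMod.natCast_eq_natCast_iff]
  push_cast
  rw [ZMod.natCast_zmod_val]; exact e

theorem noQ_zmod {p : ℕ} [Fact p.Prime] (h : noQ p) (a : ZMod p) : a ^ 2 + 2 ≠ a := by
  intro e
  apply h a.val (ZMod.val_lt a)
  rw [← Nat.ModEq, ← ZMod.natCast_eq_natCast_iff]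
  push_cast
  rw [ZMod.natCast_zmod_val]; exact e

/-- the small prime `p` needs no generator -/
def okp (p : ℕ) : Prop :=
  (noC p ∧ 213 < p ^ 3) ∨ (noQ p ∧ 213 < p ^ 2) ∨ (noC p ∧ noQ p ∧ 213 < p ^ 6)

instance : DecidablePred okp := fun p => by unfold okp; infer_instance

theorem small_primes0 : ∀ p ∈ List.range 214, p.Prime → p ≠ 2 →
    p ∉ [7, 11, 37, 107, 113, 151, 163, 179, 191, 197] → okp p := by
  decide +kernel

theorem small_primes (p : ℕ) (h : p < 214) (hp : p.Prime) (h2 : p ≠ 2)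
    (hl : p ∉ [7, 11, 37, 107, 113, 151, 163, 179, 191, 197]) :
    (noC p ∧ 213 < p ^ 3) ∨ (noQ p ∧ 213 < p ^ 2) ∨ (noC p ∧ noQ p ∧ 213 < p ^ 6) :=
  small_primes0 p (List.mem_range.2 h) hp h2 hl

variable {K : Type*} [Field K] [NumberField K] {σ : K ≃ₐ[ℚ] K}
    {g : 𝓞 K ≃ₐ[ℤ] 𝓞 K} {y w : 𝓞 K}

theorem SD.small_prime (h : SD σ g y w) (P : Ideal (𝓞 K)) (hP : P.IsPrime) (hP0 : P ≠ ⊥)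
    (hn : Ideal.absNorm P ≤ 213) : ∃ γ, IsGen g P γ := by
  have hmax : P.IsMaximal := hP.isMaximal hP0
  let k := 𝓞 K ⧸ P
  let _ : Field k := Ideal.Quotient.field P
  have hfin : Finite k := Ideal.finiteQuotientOfFreeOfNeBot P hP0
  obtain ⟨p, hchar⟩ := CharP.exists k
  have hpp : p.Prime := (CharP.char_is_prime_or_zero k p).resolve_right (by
    rintro rfl
    have : CharZero k := CharP.charP_to_charZero k
    exact not_injective_infinite_finite (Nat.cast : ℕ → k) Nat.cast_injective)
  have : Fact p.Prime := ⟨hpp⟩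
  let _ : Algebra (ZMod p) k := ZMod.algebra k p
  have hcard : Ideal.absNorm P = p ^ Module.finrank (ZMod p) k := by
    rw [Ideal.absNorm_apply, Submodule.cardQuot_apply]
    have := Module.natCard_eq_pow_finrank (K := ZMod p) (V := k)
    rw [Nat.card_zmod] at this
    exact this
  have hpP : (p : 𝓞 K) ∈ P := by
    rw [← Ideal.Quotient.eq_zero_iff_mem]
    have := CharP.cast_eq_zero k p
    rw [map_natCast]; exact this
  have hf0 : 0 < Module.finrank (ZMod p) k := Module.finrank_pos
  have hpow : ∀ d, d ∣ Module.finrank (ZMod p) k → p ^ d ≤ Ideal.absNorm P := fun d hd => by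
    rw [hcard]; exact Nat.pow_le_pow_right hpp.pos (Nat.le_of_dvd hf0 hd)
  have hC : noC p → 3 ∣ Module.finrank (ZMod p) k := fun hno => by
    have e := congrArg (Ideal.Quotient.mk P) h.hy
    simp only [map_add, map_sub, map_mul, map_pow, map_ofNat] at e
    exact three_dvd (k := k) (x := Ideal.Quotient.mk P y) e (noC_zmod hno)
  have hQ : noQ p → 2 ∣ Module.finrank (ZMod p) k := fun hno => by
    have e := congrArg (Ideal.Quotient.mk P) h.hw
    simp only [map_sub, map_pow, map_ofNat] at e
    exact two_dvd (k := k) (x := Ideal.Quotient.mk P w) e (noQ_zmod hno)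
  by_cases hl : p ∈ [7, 11, 37, 107, 113, 151, 163, 179, 191, 197]
  · obtain ⟨γ, hγ⟩ := h.gen_list hP hP0 hl hpP
    exact ⟨γ, hγ.1⟩
  by_cases h2 : p = 2
  · subst h2
    have h8 := hpow 3 (hC (by decide))
    have hv : ∀ v : 𝓞 K, v * g v = 2 → g (g v) = v → v ∈ P → ∃ γ, IsGen g P γ := by
      intro v hv1 hv2 hvP
      have hnv : Ideal.absNorm (Ideal.span {v}) = 8 := by
        have e : ((Ideal.absNorm (Ideal.span {v}) : ℕ) : 𝓞 K) = ((8 : ℕ) : 𝓞 K) := by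
          rw [h.absNorm_span]; simp only [hv2]
          calc _ = (v * g v) ^ 3 := by ring
            _ = _ := by rw [hv1]; norm_num
        exact_mod_cast e
      obtain ⟨J, hJ⟩ := Ideal.dvd_span_singleton.2 hvP
      have e := congrArg Ideal.absNorm hJ
      rw [map_mul, hnv] at e
      have e2 : Ideal.absNorm J = 1 := by
        have : Ideal.absNorm J ≠ 0 := by rintro h0; rw [h0] at e; omega
        by_contra h1
        have : 2 ≤ Ideal.absNorm J := by omega
        have := Nat.mul_le_mul h8 this
        omega
      rw [Ideal.absNorm_eq_one_iff] at e2
      rw [e2, Ideal.mul_top] at hJ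
      exact ⟨_, hJ ▸ h.gen_span v⟩
    have hmem : w * (1 - w) ∈ P := by
      have : w * (1 - w) = 2 := by linear_combination -h.hw
      rw [this]; exact_mod_cast hpP
    rcases hP.mem_or_mem hmem with hm | hm
    · exact hv w (by rw [h.gw]; linear_combination -h.hw) h.gw2 hm
    · exact hv (1 - w) (by rw [map_sub, map_one, h.gw]; linear_combination -h.hw)
        (by rw [map_sub, map_one, map_sub, map_one, h.gw2]) hm
  · exfalso
    have h1 := hpow 1 (one_dvd _)
    rw [pow_one] at h1
    rcases small_primes p (by omega) hpp h2 hl with ⟨hc, hb⟩ | ⟨hc, hb⟩ | ⟨hc, hq, hb⟩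
    · have := hpow 3 (hC hc); omega
    · have := hpow 2 (hQ hc); omega
    · have := hpow 6 (Nat.Coprime.mul_dvd_of_dvd_of_dvd (by norm_num) (hQ hq) (hC hc)); omega

theorem SD.exists_gen (h : SD σ g y w) (I : Ideal (𝓞 K)) (hI : I ≠ ⊥) : ∃ γ, IsGen g I γ :=
  h.all_gen h.small_prime I hI
end
end Shim

open NumberField
namespace Shim
section
set_option linter.unusedSectionVars false
variable {K : Type*} [Field K] [NumberField K] {σ : K ≃ₐ[ℚ] K}
    {g : 𝓞 K ≃ₐ[ℤ] 𝓞 K} {y w : 𝓞 K}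

theorem SD.torsion_dvd (h : SD σ g y w) {p : ℕ} (hp : p.Prime) (hp7 : 7 < p)
    (hl : p ∈ [7, 11, 37, 107, 113, 151, 163, 179, 191, 197]) :
    Units.torsionOrder K ∣ p - 1 := by
  have : Fact p.Prime := ⟨hp⟩
  have hne : Ideal.span {(p : 𝓞 K)} ≠ ⊤ := by
    rw [Ne, ← Ideal.absNorm_eq_one_iff, Ideal.absNorm_span_singleton]
    have e := h.norm_eq (p : 𝓞 K)
    simp only [map_natCast] at e
    have e2 : Algebra.norm ℤ (p : 𝓞 K) = (p : ℤ) ^ 6 := by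
      have e3 : ((Algebra.norm ℤ (p : 𝓞 K) : ℤ) : 𝓞 K) = (((p : ℤ) ^ 6 : ℤ) : 𝓞 K) := by
        rw [e]; push_cast; ring
      exact_mod_cast e3
    rw [e2, Int.natAbs_pow, Int.natAbs_natCast]
    exact (Nat.one_lt_pow (by norm_num) hp.one_lt).ne'
  obtain ⟨P, hP, hle⟩ := Ideal.exists_le_maximal _ hne
  have hpP : (p : 𝓞 K) ∈ P := hle (Ideal.mem_span_singleton_self _)
  have hP0 : P ≠ ⊥ := by
    rintro rfl
    rw [Ideal.mem_bot] at hpP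
    exact hp.ne_zero (by exact_mod_cast hpP)
  obtain ⟨γ, -, hn⟩ := h.gen_list hP.isPrime hP0 hl hpP
  rw [← hn]
  refine torsionOrder_dvd_absNorm_sub_one hP0 hP.isPrime ?_
  rw [hn, hp.coprime_iff_not_dvd]
  intro hdvd
  obtain ⟨ζ, hζ⟩ := exists_prime_orderOf_dvd_card' (G := Units.torsion K) p hdvd
  have h1 := IsPrimitiveRoot.orderOf ζ
  rw [hζ] at h1
  have h2 := IsPrimitiveRoot.coe_units_iff.2 (IsPrimitiveRoot.coe_submonoidClass_iff.2 h1)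
  have h3 := h2.totient_le_degree_minpoly.trans (minpoly.natDegree_le _)
  rw [RingOfIntegers.rank, h.fr, Nat.totient_prime hp] at h3
  omega

theorem SD.root_unity (h : SD σ g y w) (x : 𝓞 K) {n : ℕ} (hn : 0 < n) (hx : x ^ n = 1) :
    x = 1 ∨ x = -1 := by
  have h1 := h.torsion_dvd (p := 11) (by norm_num) (by norm_num) (by decide)
  have h2 := h.torsion_dvd (p := 37) (by norm_num) (by norm_num) (by decide)
  have h3 : Units.torsionOrder K ∣ 2 := Nat.dvd_gcd h1 h2
  have hu : IsUnit x := IsUnit.of_pow_eq_one hx hn.ne'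
  obtain ⟨u, rfl⟩ := hu
  have hu : u ∈ Units.torsion K := by
    refine (CommGroup.mem_torsion u).2 (isOfFinOrder_iff_pow_eq_one.2 ⟨n, hn, ?_⟩)
    apply Units.ext; rw [Units.val_pow_eq_pow_val, hx]; rfl
  have h4 : orderOf (⟨u, hu⟩ : Units.torsion K) ∣ 2 := (orderOf_dvd_natCard _).trans h3
  have h5 := orderOf_dvd_iff_pow_eq_one.1 h4
  have h6 : (u : 𝓞 K) ^ 2 = 1 := by
    have := congrArg (fun v : Units.torsion K => ((v : (𝓞 K)ˣ) : 𝓞 K)) h5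
    simpa using this
  exact sq_eq_one_iff.1 h6

theorem SD.uniq (h : SD σ g y w) {γ δ : 𝓞 K} (h0 : γ ≠ 0) (hs : Ideal.span {γ} = Ideal.span {δ})
    (hn : γ * g (g (g γ)) = δ * g (g (g δ))) : δ = γ ∨ δ = -γ := by
  obtain ⟨u, rfl⟩ := Ideal.span_singleton_eq_span_singleton.1 hs
  have h1 : (u : 𝓞 K) * g (g (g u)) = 1 := by
    have h2 : γ * g (g (g γ)) ≠ 0 := mul_ne_zero h0 (by simpa using h0)
    apply mul_left_cancel₀ h2
    rw [mul_one]
    nth_rw 2 [hn]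
    simp only [map_mul]; ring
  obtain ⟨n, hn, hx⟩ := Embeddings.pow_eq_one_of_norm_eq_one K ℂ (x := algebraMap (𝓞 K) K u)
    (RingOfIntegers.isIntegral_coe _) (fun φ => by
      have h2 := congrArg (fun z => φ (algebraMap (𝓞 K) K z)) h1
      simp only [map_mul, map_one, h.coe, h.conj] at h2
      rw [Complex.mul_conj] at h2
      have h3 : Complex.normSq (φ (algebraMap (𝓞 K) K u)) = 1 := by exact_mod_cast h2
      rw [Complex.normSq_eq_norm_sq] at h3
      exact (pow_eq_one_iff_of_nonneg (norm_nonneg _) (by norm_num)).1 h3)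
  have hx' : (u : 𝓞 K) ^ n = 1 := by
    apply inj (K := K); rw [map_pow, hx, map_one]
  rcases h.root_unity _ hn hx' with e | e
  · left; rw [e, mul_one]
  · right; rw [e]; ring
end
end Shim

open NumberField
namespace Shim
section
set_option linter.unusedSectionVars false
variable {K : Type*} [Field K] [NumberField K] {σ : K ≃ₐ[ℚ] K}
    {g : 𝓞 K ≃ₐ[ℤ] 𝓞 K} {y w : 𝓞 K}

/-- norm to the quadratic subfield -/
noncomputable def nn (g : 𝓞 K ≃ₐ[ℤ] 𝓞 K) (x : 𝓞 K) : 𝓞 K := x * g (g x) * g (g (g (g x)))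

/-- the sign condition -/
def Sgn (g : 𝓞 K ≃ₐ[ℤ] 𝓞 K) (x : 𝓞 K) : Prop :=
  ∃ t : ℤ, nn g x + g (nn g x) = t ∧ (t : ZMod 7) ^ 3 = 1

theorem SD.nn2 (h : SD σ g y w) (x : 𝓞 K) : g (g (nn g x)) = nn g x := by
  simp only [nn, map_mul, h.g6]; ring

theorem nn_g (x : 𝓞 K) : nn g (g x) = g (nn g x) := by
  simp only [nn, map_mul]

theorem nn_neg (x : 𝓞 K) : nn g (-x) = - nn g x := by
  simp only [nn, map_neg]; ring

theorem nn_mul (x z : 𝓞 K) : nn g (x * z) = nn g x * nn g z := by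
  simp only [nn, map_mul]; ring

theorem SD.exists_t (h : SD σ g y w) (x : 𝓞 K) : ∃ t : ℤ, nn g x + g (nn g x) = t :=
  h.fixed _ (by rw [map_add, h.nn2]; ring)

theorem SD.data (h : SD σ g y w) {x : 𝓞 K} {N : ℕ} (hx : x * g (g (g x)) = N) (hN : ¬ 7 ∣ N) :
    ∃ t e : ℤ, nn g x + g (nn g x) = t ∧ (2 * w - 1) * (nn g x - g (nn g x)) = e ∧ 7 ∣ e ∧
      (t : ZMod 7) ≠ 0 := by
  obtain ⟨t, ht⟩ := h.exists_t x
  obtain ⟨e, he⟩ := h.fixed ((2 * w - 1) * (nn g x - g (nn g x))) (by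
    simp only [map_mul, map_sub, map_one, map_ofNat, h.gw, h.nn2]; ring)
  have hnn : nn g x * g (nn g x) = (N : 𝓞 K) ^ 3 := by
    have e2 := congrArg (fun z => g (g z)) hx
    have e4 := congrArg (fun z => g (g (g (g z)))) hx
    simp only [map_mul, map_natCast, h.g6] at e2 e4
    simp only [nn, map_mul]
    calc _ = (x * g (g (g x))) * (g (g x) * g (g (g (g (g x))))) * (g (g (g (g x))) * g x) := by ring
      _ = _ := by rw [hx, e2, e4]; ring
  have h1 : e ^ 2 = -7 * (t ^ 2 - 4 * (N : ℤ) ^ 3) := by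
    have h2 : (e : 𝓞 K) ^ 2 = -7 * ((t : 𝓞 K) ^ 2 - 4 * (N : 𝓞 K) ^ 3) := by
      rw [← he, ← ht, ← hnn]
      linear_combination 4 * (nn g x - g (nn g x)) ^ 2 * h.hw
    exact_mod_cast h2
  have h7 : (7 : ℤ) ∣ e := by
    have : (7 : ℤ) ∣ e ^ 2 := ⟨-(t ^ 2 - 4 * (N : ℤ) ^ 3), by rw [h1]; ring⟩
    exact (Nat.prime_iff_prime_int.1 (by norm_num : Nat.Prime 7)).dvd_of_dvd_pow this
  refine ⟨t, e, ht, he, h7, ?_⟩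
  intro h0
  have h8 : (7 : ℤ) ∣ t := (ZMod.intCast_zmod_eq_zero_iff_dvd t 7).1 h0
  obtain ⟨a, rfl⟩ := h7
  obtain ⟨b, rfl⟩ := h8
  have h9 : (7 : ℤ) ∣ 4 * (N : ℤ) ^ 3 := ⟨a ^ 2 + 7 * b ^ 2, by linarith⟩
  have h10 : (7 : ℤ) ∣ (N : ℤ) ^ 3 := IsCoprime.dvd_of_dvd_mul_left (by norm_num) h9
  have h11 := (Nat.prime_iff_prime_int.1 (by norm_num : Nat.Prime 7)).dvd_of_dvd_pow h10
  exact hN (by exact_mod_cast h11)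

theorem zmod7 : ∀ a : ZMod 7, a ≠ 0 → a ^ 3 = 1 ∨ (-a) ^ 3 = 1 := by decide

theorem SD.sgn_or (h : SD σ g y w) {x : 𝓞 K} {N : ℕ} (hx : x * g (g (g x)) = N) (hN : ¬ 7 ∣ N) :
    Sgn g x ∨ Sgn g (-x) := by
  obtain ⟨t, e, ht, -, -, h0⟩ := h.data hx hN
  rcases zmod7 _ h0 with h1 | h1
  · exact Or.inl ⟨t, ht, h1⟩
  · refine Or.inr ⟨-t, ?_, by push_cast; exact h1⟩
    rw [nn_neg, map_neg]; push_cast; rw [← ht]; ring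

theorem not_both {x : 𝓞 K} (h1 : Sgn g x) (h2 : Sgn g (-x)) : False := by
  obtain ⟨t, ht, h1⟩ := h1
  obtain ⟨t', ht', h2⟩ := h2
  have : t' = -t := by
    have : (t' : 𝓞 K) = ((-t : ℤ) : 𝓞 K) := by
      rw [← ht', nn_neg, map_neg]; push_cast; rw [← ht]; ring
    exact_mod_cast this
  rw [this] at h2
  push_cast at h2
  rw [neg_pow, h1] at h2
  revert h2; decide

theorem SD.sgn_g (h : SD σ g y w) {x : 𝓞 K} (h1 : Sgn g x) : Sgn g (g x) := by
  obtain ⟨t, ht, h1⟩ := h1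
  refine ⟨t, ?_, h1⟩
  rw [nn_g, h.nn2, ← ht]; ring

theorem SD.sgn_mul (h : SD σ g y w) {x z : 𝓞 K} {N M : ℕ} (hx : x * g (g (g x)) = N)
    (hN : ¬ 7 ∣ N) (hz : z * g (g (g z)) = M) (hM : ¬ 7 ∣ M) (h1 : Sgn g x) (h2 : Sgn g z) :
    Sgn g (x * z) := by
  obtain ⟨t, ht, h1⟩ := h1
  obtain ⟨t', ht', h2⟩ := h2
  obtain ⟨_, e, -, he, ⟨a, rfl⟩, -⟩ := h.data hx hN
  obtain ⟨_, e', -, he', ⟨b, rfl⟩, -⟩ := h.data hz hM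
  obtain ⟨T, hT⟩ := h.exists_t (x * z)
  refine ⟨T, hT, ?_⟩
  have key : (7 : ℤ) * (2 * T - t * t') = - ((7 * a) * (7 * b)) := by
    have : (7 : 𝓞 K) * (2 * T - t * t') = - (((7 * a : ℤ) : 𝓞 K) * ((7 * b : ℤ) : 𝓞 K)) := by
      rw [← he, ← he', ← hT, ← ht, ← ht', nn_mul, map_mul]
      linear_combination 4 * (nn g x - g (nn g x)) * (nn g z - g (nn g z)) * h.hw
    exact_mod_cast this
  have key2 : 2 * T = t * t' - 7 * (a * b) := by linarith
  have key3 := congrArg (Int.cast (R := ZMod 7)) key2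
  push_cast at key3
  have h7 : (7 : ZMod 7) = 0 := by decide
  rw [h7, zero_mul, sub_zero] at key3
  have key4 : (T : ZMod 7) = 4 * (t * t') := by
    rw [← key3]; 
    have h8 : (8 : ZMod 7) = 1 := by decide
    linear_combination -(T : ZMod 7) * h8
  rw [key4, mul_pow, mul_pow, h1, h2]; decide

theorem SD.sgn_one (h : SD σ g y w) {x : 𝓞 K} (hx : x - 1 ∈ Ideal.span {(7 : 𝓞 K)}) :
    Sgn g (phi g x) := by
  let C : 𝓞 K → Prop := fun z => ∃ a, z = 1 + 7 * a
  have cm : ∀ {u v : 𝓞 K}, C u → C v → C (u * v) := by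
    rintro u v ⟨a, rfl⟩ ⟨b, rfl⟩; exact ⟨a + b + 7 * a * b, by ring⟩
  have cg : ∀ {u : 𝓞 K}, C u → C (g u) := by
    rintro u ⟨a, rfl⟩; exact ⟨g a, by simp only [map_add, map_mul, map_one, map_ofNat]⟩
  have c1 : C x := by
    obtain ⟨a, ha⟩ := Ideal.mem_span_singleton.1 hx
    exact ⟨a, by rw [← ha]; ring⟩
  have c2 : C (phi g x) := cm (cm c1 (cg (cg (cg (cg c1))))) (cg (cg (cg (cg (cg c1)))))
  have c3 : C (nn g (phi g x)) := cm (cm c2 (cg (cg c2))) (cg (cg (cg (cg c2))))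
  obtain ⟨a, ha⟩ := c3
  have hf := h.nn2 (phi g x)
  obtain ⟨m, hm⟩ := h.fixed (a + g a) (by
    rw [ha] at hf
    simp only [map_add, map_mul, map_one, map_ofNat] at hf
    have h7 : (7 : 𝓞 K) ≠ 0 := by norm_num
    have : g (g a) = a := mul_left_cancel₀ h7 (by linear_combination hf)
    rw [map_add, this]; ring)
  refine ⟨2 + 7 * m, ?_, ?_⟩
  · rw [ha]; push_cast; rw [← hm]; simp only [map_add, map_mul, map_one, map_ofNat]; ring
  · push_cast
    have h7 : (7 : ZMod 7) = 0 := by decide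
    rw [h7, zero_mul]; decide

theorem coprime_norm {I : Ideal (𝓞 K)} (hI0 : I ≠ ⊥)
    (hI : IsCoprime I (Ideal.span {(7 : 𝓞 K)})) : ¬ 7 ∣ Ideal.absNorm I := by
  intro hd
  have hfin : Finite (𝓞 K ⧸ I) := Ideal.finiteQuotientOfFreeOfNeBot I hI0
  rw [Ideal.absNorm_apply, Submodule.cardQuot_apply] at hd
  have : Fact (Nat.Prime 7) := ⟨by norm_num⟩
  obtain ⟨x, hx⟩ := exists_prime_addOrderOf_dvd_card' (G := 𝓞 K ⧸ I) 7 hd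
  obtain ⟨x, rfl⟩ := Ideal.Quotient.mk_surjective x
  obtain ⟨i, hi, j, hj, hij⟩ := Ideal.isCoprime_iff_exists.1 hI
  obtain ⟨c, rfl⟩ := Ideal.mem_span_singleton.1 hj
  have h1 : (7 : ℕ) • (Ideal.Quotient.mk I x) = 0 := by rw [← hx]; exact addOrderOf_nsmul_eq_zero _
  have h2 : Ideal.Quotient.mk I x = 0 := by
    have e1 : x = i * x + c * (7 * x) := by linear_combination -x * hij
    have e2 := congrArg (Ideal.Quotient.mk I) e1
    rw [map_add, map_mul, map_mul, Ideal.Quotient.eq_zero_iff_mem.2 hi] at e2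
    rw [nsmul_eq_mul] at h1
    rw [e2, map_mul]
    have : (Ideal.Quotient.mk I) 7 = ((7 : ℕ) : 𝓞 K ⧸ I) := by rw [map_ofNat]; rfl
    rw [this, h1]; simp
  rw [h2] at hx
  simp at hx

open Classical in
/-- the ideal character, with values in the ring of integers -/
noncomputable def psi (g : 𝓞 K ≃ₐ[ℤ] 𝓞 K) (I : Ideal (𝓞 K)) : 𝓞 K :=
  if h : ∃ γ, IsGen g I γ ∧ Sgn g γ then h.choose else 0

theorem IsGen.ne_zero {I : Ideal (𝓞 K)} {γ : 𝓞 K} (hI : I ≠ ⊥) (h : IsGen g I γ) : γ ≠ 0 := by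
  rintro rfl
  apply Phi_ne_bot (g := g) hI
  rw [← h.1]; simp

theorem SD.psi_spec (h : SD σ g y w) {I : Ideal (𝓞 K)} (hI0 : I ≠ ⊥)
    (hI : IsCoprime I (Ideal.span {(7 : 𝓞 K)})) : IsGen g I (psi g I) ∧ Sgn g (psi g I) := by
  have hex : ∃ γ, IsGen g I γ ∧ Sgn g γ := by
    obtain ⟨γ, hγ⟩ := h.exists_gen I hI0
    rcases h.sgn_or hγ.2 (coprime_norm hI0 hI) with h1 | h1
    · exact ⟨γ, hγ, h1⟩
    · refine ⟨-γ, ⟨?_, ?_⟩, h1⟩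
      · rw [Ideal.span_singleton_neg]; exact hγ.1
      · rw [← hγ.2]; simp only [map_neg]; ring
  rw [psi, dif_pos hex]
  exact hex.choose_spec

theorem SD.psi_eq (h : SD σ g y w) {I : Ideal (𝓞 K)} (hI0 : I ≠ ⊥)
    (hI : IsCoprime I (Ideal.span {(7 : 𝓞 K)})) {γ : 𝓞 K} (h1 : IsGen g I γ) (h2 : Sgn g γ) :
    psi g I = γ := by
  obtain ⟨h3, h4⟩ := h.psi_spec hI0 hI
  rcases h.uniq (h1.ne_zero hI0) (h1.1.trans h3.1.symm) (h1.2.trans h3.2.symm) with e | e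
  · exact e
  · rw [e] at h4; exact (not_both h2 h4).elim
end
end Shim

open NumberField
namespace Shim
section
set_option linter.unusedSectionVars false

theorem z7a : (-1 : ZMod 7) ^ 3 * -1 = 1 := by decide
theorem z7b : ¬ IsSquare (-1 : ZMod 7) := by decide
theorem z7c : (2 : ZMod 7) ^ 3 = 1 := by decide

theorem qc7 [Fact (Nat.Prime 7)] (a : ZMod 7) (h : quadraticChar (ZMod 7) a = 1) : a ^ 3 = 1 := by
  have h1 := quadraticChar_eq_pow_of_char_ne_two' (F := ZMod 7) (by simp [ZMod.ringChar_zmod_n]) a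
  rw [h, ZMod.card] at h1
  simpa using h1.symm

theorem qc7' [Fact (Nat.Prime 7)] (a : ZMod 7) (h : quadraticChar (ZMod 7) a = -1) :
    (-a) ^ 3 = 1 := by
  have h1 := quadraticChar_eq_pow_of_char_ne_two' (F := ZMod 7) (by simp [ZMod.ringChar_zmod_n]) a
  rw [h, ZMod.card] at h1
  have : a ^ 3 = -1 := by simpa using h1.symm
  rw [neg_pow, this]; exact z7a

theorem qc_neg7 {k : Type*} [Field k] [Fintype k] [DecidableEq k] [Fact (Nat.Prime 7)]
    (h7 : (7 : k) ≠ 0) (h2 : ringChar k ≠ 2) :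
    quadraticChar k (-7) = quadraticChar (ZMod 7) (Fintype.card k : ZMod 7) := by
  have hc : ringChar k ≠ 7 := by
    intro h
    apply h7
    have := ringChar.Nat.cast_ringChar (R := k)
    rw [h] at this
    exact_mod_cast this
  have e1 := quadraticChar_odd_prime h2 (p := 7) (by norm_num) hc
  have e2 := quadraticChar_neg_one h2
  have e3 : (-7 : k) = (-1) * ((7 : ℕ) : k) := by push_cast; ring
  rw [e3, map_mul, e1, e2, map_mul]
  have hodd := FiniteField.odd_card_of_char_ne_two h2
  have h4 : (Fintype.card k : ZMod 4) = 1 ∨ (Fintype.card k : ZMod 4) = 3 := by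
    have : Fintype.card k % 4 = 1 ∨ Fintype.card k % 4 = 3 := by omega
    rw [← ZMod.natCast_mod]
    rcases this with h | h <;> rw [h]
    · left; rfl
    · right; rfl
  have hneg : quadraticChar (ZMod 7) (-1) = -1 := by
    rw [quadraticChar_neg_one_iff_not_isSquare]
    exact z7b
  rcases h4 with h4 | h4 <;> rw [h4]
  · rw [show ZMod.χ₄ 1 = 1 by rfl]; simp
  · rw [show ZMod.χ₄ 3 = -1 by rfl]
    rw [show (((-1 : ℤ) : ZMod 7)) = -1 by simp, hneg]; ring

theorem sq_card {k : Type*} [Field k] [Finite k] (h7 : (7 : k) ≠ 0) (hs : IsSquare (-7 : k)) :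
    ((Nat.card k : ℕ) : ZMod 7) ^ 3 = 1 := by
  classical
  have : Fact (Nat.Prime 7) := ⟨by norm_num⟩
  have := Fintype.ofFinite k
  rw [Nat.card_eq_fintype_card]
  by_cases h2 : ringChar k = 2
  · have hch : CharP k 2 := by rw [← h2]; infer_instance
    obtain ⟨n, -, hn⟩ := FiniteField.card k 2
    rw [hn]
    push_cast
    rw [← pow_mul, mul_comm, pow_mul]
    rw [z7c, one_pow]
  · apply qc7
    rw [← qc_neg7 h7 h2]
    exact (quadraticChar_one_iff_isSquare (neg_ne_zero.2 h7)).2 hs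

theorem nsq_card {k : Type*} [Field k] [Finite k] (h7 : (7 : k) ≠ 0) (h2 : (2 : k) ≠ 0)
    (hs : ¬ IsSquare (-7 : k)) : (-((Nat.card k : ℕ) : ZMod 7)) ^ 3 = 1 := by
  classical
  have : Fact (Nat.Prime 7) := ⟨by norm_num⟩
  have := Fintype.ofFinite k
  rw [Nat.card_eq_fintype_card]
  have h2 : ringChar k ≠ 2 := by
    intro h
    apply h2
    have := ringChar.Nat.cast_ringChar (R := k)
    rw [h] at this
    exact_mod_cast this
  apply qc7'
  rw [← qc_neg7 h7 h2]
  exact quadraticChar_neg_one_iff_not_isSquare.2 hs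

variable {K : Type*} [Field K] [NumberField K] {σ : K ≃ₐ[ℚ] K}
    {g : 𝓞 K ≃ₐ[ℤ] 𝓞 K} {y w : 𝓞 K}

theorem SD.g3_alg (h : SD σ g y w) (x : 𝓞 (cubicFixedField σ)) :
    g (g (g (algebraMap _ (𝓞 K) x))) = algebraMap _ (𝓞 K) x := by
  apply inj
  rw [h.coe, h.coe, h.coe]
  have h1 : ((x : cubicFixedField σ) : K) ∈ cubicFixedField σ := (x : cubicFixedField σ).2
  have h2 := (IntermediateField.mem_fixedField_iff _ _).1 h1 (σ ^ 3) (Subgroup.mem_zpowers _)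
  exact h2

theorem SD.g3_map (h : SD σ g y w) (p : Ideal (𝓞 (cubicFixedField σ))) :
    Ideal.map g (Ideal.map g (Ideal.map g (Ideal.map (algebraMap _ (𝓞 K)) p))) =
      Ideal.map (algebraMap _ (𝓞 K)) p := by
  have h1 : ((g : 𝓞 K →+* 𝓞 K).comp ((g : 𝓞 K →+* 𝓞 K).comp ((g : 𝓞 K →+* 𝓞 K).comp
      (algebraMap (𝓞 (cubicFixedField σ)) (𝓞 K))))) = algebraMap (𝓞 (cubicFixedField σ)) (𝓞 K) := by
    ext1 x; exact h.g3_alg x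
  conv_rhs => rw [← h1]
  rw [← Ideal.map_map, ← Ideal.map_map, ← Ideal.map_map]
  rfl

theorem SD.norm_map (h : SD σ g y w) (p : Ideal (𝓞 (cubicFixedField σ))) :
    Ideal.absNorm (Ideal.map (algebraMap _ (𝓞 K)) p) = Ideal.absNorm p ^ 2 := by
  rw [Ideal.absNorm_algebraMap, ← IsFractionRing.finrank_eq (𝓞 (cubicFixedField σ))
    (cubicFixedField σ) (𝓞 K) K]
  congr 1
  unfold cubicFixedField
  rw [IntermediateField.finrank_fixedField_eq_card, Nat.card_zpowers, orderOf_pow, h.ord]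
  rfl

theorem SD.sgn_int (h : SD σ g y w) (c : ℤ) (hc : (c : ZMod 7) ^ 3 = 1) : Sgn g (c : 𝓞 K) := by
  refine ⟨2 * c ^ 3, ?_, ?_⟩
  · simp only [nn, map_mul, map_intCast]; push_cast; ring
  · push_cast; rw [hc]; decide

theorem SD.psi_map (h : SD σ g y w) (p : Ideal (𝓞 (cubicFixedField σ))) (hp0 : p ≠ ⊥)
    (hc : IsCoprime (Ideal.map (algebraMap (𝓞 (cubicFixedField σ)) (𝓞 K)) p)
      (Ideal.span {(7 : 𝓞 K)})) :
    psi g (Ideal.map (algebraMap _ (𝓞 K)) p) = ((Ideal.absNorm p : ℤ) : 𝓞 K) ∨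
    psi g (Ideal.map (algebraMap _ (𝓞 K)) p) = ((-(Ideal.absNorm p : ℤ) : ℤ) : 𝓞 K) := by
  have hinj : Function.Injective (algebraMap (𝓞 (cubicFixedField σ)) (𝓞 K)) :=
    FaithfulSMul.algebraMap_injective _ _
  have hJ0 : Ideal.map (algebraMap (𝓞 (cubicFixedField σ)) (𝓞 K)) p ≠ ⊥ := by
    rwa [Ne, Ideal.map_eq_bot_iff_of_injective hinj]
  obtain ⟨h1, h2⟩ := h.psi_spec hJ0 hc
  have hJ := h.g3_map p
  have hN := h.norm_map p
  set J := Ideal.map (algebraMap (𝓞 (cubicFixedField σ)) (𝓞 K)) p with hJdef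
  set γ := psi g J
  have hg0 := h1.ne_zero hJ0
  have e1 : Ideal.span {γ} = Ideal.span {g (g (g γ))} := by
    rw [← map_span, ← map_span, ← map_span, h1.1]
    simp only [Phi, Ideal.map_mul, hJ]
  have h3 := h1.2
  rw [hN] at h3
  push_cast at h3
  rcases h.uniq hg0 e1 (by rw [h.g6]; ring) with e | e
  · rw [e, ← sq] at h3
    rcases sq_eq_sq_iff_eq_or_eq_neg.1 h3 with e2 | e2
    · left; rw [e2]; simp
    · right; rw [e2]; simp
  · exfalso
    obtain ⟨t, ht, ht1⟩ := h2
    have e3 : g (nn g γ) = - nn g γ := by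
      have e4 : g (g (g (nn g γ))) = nn g (g (g (g γ))) := by rw [nn_g, nn_g, nn_g]
      rw [h.nn2, e, nn_neg] at e4
      exact e4
    rw [e3, add_neg_cancel] at ht
    have : t = 0 := by exact_mod_cast ht.symm
    rw [this] at ht1
    revert ht1; decide

theorem SD.psi_sgn (h : SD σ g y w) (p : Ideal (𝓞 (cubicFixedField σ))) (hp0 : p ≠ ⊥)
    (hc : IsCoprime (Ideal.map (algebraMap (𝓞 (cubicFixedField σ)) (𝓞 K)) p)
      (Ideal.span {(7 : 𝓞 K)})) (ε : ℤ) (hε : ε = 1 ∨ ε = -1)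
    (hs : (((ε * (Ideal.absNorm p : ℤ)) : ℤ) : ZMod 7) ^ 3 = 1) :
    psi g (Ideal.map (algebraMap _ (𝓞 K)) p) = ((ε * (Ideal.absNorm p : ℤ) : ℤ) : 𝓞 K) := by
  have hinj : Function.Injective (algebraMap (𝓞 (cubicFixedField σ)) (𝓞 K)) :=
    FaithfulSMul.algebraMap_injective _ _
  have hJ0 : Ideal.map (algebraMap (𝓞 (cubicFixedField σ)) (𝓞 K)) p ≠ ⊥ := by
    rwa [Ne, Ideal.map_eq_bot_iff_of_injective hinj]
  have h2 := (h.psi_spec hJ0 hc).2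
  have h3 := h.sgn_int _ hs
  rcases h.psi_map p hp0 hc with e | e <;> rcases hε with rfl | rfl
  · rw [e]; simp
  · exfalso
    rw [e] at h2
    exact not_both h2 (by simpa using h3)
  · exfalso
    rw [e] at h2
    exact not_both h3 (by simpa using h2)
  · rw [e]; simp

theorem SD.split (h : SD σ g y w) (p : Ideal (𝓞 (cubicFixedField σ))) (hp : p.IsPrime)
    (hp0 : p ≠ ⊥)
    (hc : IsCoprime (Ideal.map (algebraMap (𝓞 (cubicFixedField σ)) (𝓞 K)) p)
      (Ideal.span {(7 : 𝓞 K)})) (Q₁ Q₂ : Ideal (𝓞 K)) (h1 : Q₁.IsPrime) (h2 : Q₂.IsPrime)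
    (he : Ideal.map (algebraMap (𝓞 (cubicFixedField σ)) (𝓞 K)) p = Q₁ * Q₂) :
    psi g (Ideal.map (algebraMap _ (𝓞 K)) p) = ((Ideal.absNorm p : ℕ) : 𝓞 K) := by
  have hinj : Function.Injective (algebraMap (𝓞 (cubicFixedField σ)) (𝓞 K)) :=
    FaithfulSMul.algebraMap_injective _ _
  have hJ0 : Ideal.map (algebraMap (𝓞 (cubicFixedField σ)) (𝓞 K)) p ≠ ⊥ := by
    rwa [Ne, Ideal.map_eq_bot_iff_of_injective hinj]
  have hpm : p.IsMaximal := hp.isMaximal hp0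
  have hQ0 : Q₁ ≠ ⊥ ∧ Q₂ ≠ ⊥ := by
    rw [he] at hJ0
    exact ⟨left_ne_zero_of_mul hJ0, right_ne_zero_of_mul hJ0⟩
  have card : ∀ Q : Ideal (𝓞 K), Q.IsPrime → Q ≠ ⊥ →
      Ideal.map (algebraMap (𝓞 (cubicFixedField σ)) (𝓞 K)) p ≤ Q →
      Ideal.absNorm p ≤ Ideal.absNorm Q := by
    intro Q hQ hQ0 hle
    have hfin : Finite (𝓞 K ⧸ Q) := Ideal.finiteQuotientOfFreeOfNeBot Q hQ0
    let _ : Field (𝓞 (cubicFixedField σ) ⧸ p) := Ideal.Quotient.field p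
    let f := Ideal.quotientMap Q (algebraMap (𝓞 (cubicFixedField σ)) (𝓞 K)) (Ideal.map_le_iff_le_comap.1 hle)
    rw [Ideal.absNorm_apply, Ideal.absNorm_apply, Submodule.cardQuot_apply, Submodule.cardQuot_apply]
    refine Nat.card_le_card_of_injective f (RingHom.injective f)
  have hle1 : Ideal.map (algebraMap (𝓞 (cubicFixedField σ)) (𝓞 K)) p ≤ Q₁ := by
    rw [he]; exact Ideal.mul_le_left
  have hle2 : Ideal.map (algebraMap (𝓞 (cubicFixedField σ)) (𝓞 K)) p ≤ Q₂ := by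
    rw [he]; exact Ideal.mul_le_right
  have c1 := card Q₁ h1 hQ0.1 hle1
  have c2 := card Q₂ h2 hQ0.2 hle2
  have hN := h.norm_map p
  rw [he, map_mul] at hN
  have hpos : 0 < Ideal.absNorm p := Nat.pos_of_ne_zero (by rwa [Ne, Ideal.absNorm_eq_zero_iff])
  have hq : Ideal.absNorm Q₁ = Ideal.absNorm p := by nlinarith
  have hm1 : Q₁.IsMaximal := h1.isMaximal hQ0.1
  let _ : Field (𝓞 K ⧸ Q₁) := Ideal.Quotient.field Q₁
  have hfin : Finite (𝓞 K ⧸ Q₁) := Ideal.finiteQuotientOfFreeOfNeBot Q₁ hQ0.1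
  have key : ((Nat.card (𝓞 K ⧸ Q₁) : ℕ) : ZMod 7) ^ 3 = 1 := by
    apply sq_card
    · intro h7
      have h7' : (7 : 𝓞 K) ∈ Q₁ := by
        rw [← Ideal.Quotient.eq_zero_iff_mem, map_ofNat]; exact h7
      obtain ⟨i, hi, j, hj, hij⟩ := Ideal.isCoprime_iff_exists.1 hc
      apply h1.ne_top
      rw [Ideal.eq_top_iff_one, ← hij]
      exact Q₁.add_mem (hle1 hi) ((Ideal.span_singleton_le_iff_mem _).2 h7' hj)
    · refine ⟨Ideal.Quotient.mk Q₁ (2 * w - 1), ?_⟩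
      rw [← map_mul, show (2 * w - 1) * (2 * w - 1) = (-7 : 𝓞 K) by linear_combination 4 * h.hw,
        map_neg, map_ofNat]
  rw [← Submodule.cardQuot_apply, ← Ideal.absNorm_apply, hq] at key
  have := h.psi_sgn p hp0 hc 1 (Or.inl rfl) (by simpa using key)
  simpa using this

theorem SD.inert (h : SD σ g y w) (p : Ideal (𝓞 (cubicFixedField σ))) (hp : p.IsPrime)
    (hp0 : p ≠ ⊥)
    (hc : IsCoprime (Ideal.map (algebraMap (𝓞 (cubicFixedField σ)) (𝓞 K)) p)
      (Ideal.span {(7 : 𝓞 K)}))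
    (hJ : (Ideal.map (algebraMap (𝓞 (cubicFixedField σ)) (𝓞 K)) p).IsPrime) :
    psi g (Ideal.map (algebraMap _ (𝓞 K)) p) = -((Ideal.absNorm p : ℕ) : 𝓞 K) := by
  have hpm : p.IsMaximal := hp.isMaximal hp0
  let _ : Field (𝓞 (cubicFixedField σ) ⧸ p) := Ideal.Quotient.field p
  have hfin : Finite (𝓞 (cubicFixedField σ) ⧸ p) := Ideal.finiteQuotientOfFreeOfNeBot p hp0
  have g3 : ∀ x, x ∈ Ideal.map (algebraMap (𝓞 (cubicFixedField σ)) (𝓞 K)) p →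
      g (g (g x)) ∈ Ideal.map (algebraMap (𝓞 (cubicFixedField σ)) (𝓞 K)) p := by
    intro x hx
    rw [← h.g3_map p]; simp only [mem_map]; exact hx
  have mm : ∀ x, x ∈ p → algebraMap _ (𝓞 K) x ∈
      Ideal.map (algebraMap (𝓞 (cubicFixedField σ)) (𝓞 K)) p := fun x hx => Ideal.mem_map_of_mem _ hx
  have n7 : (7 : 𝓞 K) ∉ Ideal.map (algebraMap (𝓞 (cubicFixedField σ)) (𝓞 K)) p := by
    intro h7
    obtain ⟨i, hi, j, hj, hij⟩ := Ideal.isCoprime_iff_exists.1 hc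
    apply hJ.ne_top
    rw [Ideal.eq_top_iff_one, ← hij]
    exact Ideal.add_mem _ hi ((Ideal.span_singleton_le_iff_mem _).2 h7 hj)
  have n2 : (2 : 𝓞 K) ∉ Ideal.map (algebraMap (𝓞 (cubicFixedField σ)) (𝓞 K)) p := by
    intro h2
    have e : w * (1 - w) = 2 := by linear_combination -h.hw
    rw [← e] at h2
    apply hJ.ne_top
    rw [Ideal.eq_top_iff_one]
    rcases hJ.mem_or_mem h2 with h3 | h3
    all_goals
      have h4 := Ideal.add_mem _ h3 (g3 _ h3)
      simp only [map_sub, map_one, h.gw] at h4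
      convert h4 using 1
      ring
  have key : (-((Nat.card (𝓞 (cubicFixedField σ) ⧸ p) : ℕ) : ZMod 7)) ^ 3 = 1 := by
    apply nsq_card
    · intro h7
      have h7' : (7 : 𝓞 (cubicFixedField σ)) ∈ p := by
        rw [← Ideal.Quotient.eq_zero_iff_mem, map_ofNat]; exact h7
      exact n7 (by simpa only [map_ofNat] using mm _ h7')
    · intro h7
      have h7' : (2 : 𝓞 (cubicFixedField σ)) ∈ p := by
        rw [← Ideal.Quotient.eq_zero_iff_mem, map_ofNat]; exact h7
      exact n2 (by simpa only [map_ofNat] using mm _ h7')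
    · rintro ⟨c, hcc⟩
      obtain ⟨c, rfl⟩ := Ideal.Quotient.mk_surjective c
      have h1 : c * c + 7 ∈ p := by
        rw [← Ideal.Quotient.eq_zero_iff_mem, map_add, map_mul, map_ofNat]
        have : (7 : 𝓞 (cubicFixedField σ) ⧸ p) = -(-7) := by ring
        rw [this]
        exact (add_eq_zero_iff_eq_neg).2 (by rw [neg_neg]; exact hcc.symm)
      have h2 := mm _ h1
      rw [map_add, map_mul, map_ofNat] at h2
      have hcg := h.g3_alg c
      set d := algebraMap _ (𝓞 K) c
      have e : d * d + 7 = (2 * w - 1 - d) * (-(2 * w - 1) - d) := by linear_combination 4 * h.hw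
      rw [e] at h2
      have h28 : (2 : 𝓞 K) * 2 * 7 ∈ Ideal.map (algebraMap (𝓞 (cubicFixedField σ)) (𝓞 K)) p := by
        rcases hJ.mem_or_mem h2 with h3 | h3
        · have h4 := Ideal.sub_mem _ h3 (g3 _ h3)
          simp only [map_sub, map_mul, map_one, map_ofNat, h.gw, hcg] at h4
          have h5 := Ideal.mul_mem_left _ (-2 * (2 * w - 1)) h4
          convert h5 using 1
          linear_combination 16 * h.hw
        · have h4 := Ideal.sub_mem _ h3 (g3 _ h3)
          simp only [map_sub, map_neg, map_mul, map_one, map_ofNat, h.gw, hcg] at h4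
          have h5 := Ideal.mul_mem_left _ (2 * (2 * w - 1)) h4
          convert h5 using 1
          linear_combination 16 * h.hw
      rcases hJ.mem_or_mem h28 with h3 | h3
      · rcases hJ.mem_or_mem h3 with h4 | h4 <;> exact n2 h4
      · exact n7 h3
  rw [← Submodule.cardQuot_apply, ← Ideal.absNorm_apply] at key
  have := h.psi_sgn p hp0 hc (-1) (Or.inr rfl) (by simpa using key)
  simpa using this
end
end Shim

open NumberField
namespace Shim
section
variable {K : Type*} [Field K] [NumberField K] {σ : K ≃ₐ[ℚ] K}
    {g : 𝓞 K ≃ₐ[ℤ] 𝓞 K} {y w : 𝓞 K}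

theorem coprime_map (f : 𝓞 K ≃ₐ[ℤ] 𝓞 K) {I : Ideal (𝓞 K)}
    (hI : IsCoprime I (Ideal.span {(7 : 𝓞 K)})) :
    IsCoprime (Ideal.map f I) (Ideal.span {(7 : 𝓞 K)}) := by
  obtain ⟨i, hi, j, hj, hij⟩ := Ideal.isCoprime_iff_exists.1 hI
  refine Ideal.isCoprime_iff_exists.2 ⟨f i, Ideal.mem_map_of_mem _ hi, f j, ?_, ?_⟩
  · obtain ⟨a, rfl⟩ := Ideal.mem_span_singleton'.1 hj
    exact Ideal.mem_span_singleton'.2 ⟨f a, by rw [map_mul, map_ofNat]⟩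
  · rw [← map_add, hij, map_one]

theorem IsGen.map {I : Ideal (𝓞 K)} {γ : 𝓞 K} (h1 : IsGen g I γ) :
    IsGen g (Ideal.map g I) (g γ) := by
  refine ⟨?_, ?_⟩
  · rw [← map_span, h1.1]
    simp only [Phi, Ideal.map_mul]
  · rw [absNorm_map, ← map_mul, h1.2, map_natCast]

theorem SD.char (h : SD σ g y w) :
    IsShimuraIdealChar σ (Ideal.span {(7 : 𝓞 K)}) (fun I => algebraMap (𝓞 K) K (psi g I)) := by
  refine ⟨?_, ?_, ?_, ?_, ?_, ?_⟩
  · intro I hI0 hI h0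
    apply ((h.psi_spec hI0 hI).1.ne_zero hI0)
    apply inj
    rw [map_zero]; exact h0
  · intro I J hI0 hJ0 hI hJ
    obtain ⟨a1, a2⟩ := h.psi_spec hI0 hI
    obtain ⟨b1, b2⟩ := h.psi_spec hJ0 hJ
    have e := h.psi_eq (mul_ne_zero hI0 hJ0) (IsCoprime.mul_left hI hJ) (a1.mul b1)
      (h.sgn_mul a1.2 (coprime_norm hI0 hI) b1.2 (coprime_norm hJ0 hJ) a2 b2)
    simp only []
    rw [e, map_mul]
  · intro s hs hs1
    have h1 := h.sgn_one hs1
    have hs0 : s ≠ 0 := by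
      rintro rfl
      obtain ⟨t, ht, ht1⟩ := h1
      simp only [phi, nn, map_zero, mul_zero, add_zero] at ht
      have : t = 0 := by exact_mod_cast ht.symm
      rw [this] at ht1
      revert ht1; decide
    have e := h.psi_eq (by rwa [Ne, Ideal.span_singleton_eq_bot]) hs (h.gen_span s) h1
    simp only []
    rw [e]
    simp only [phi, map_mul, h.coe]
    rfl
  · intro p hp hp0 hc
    refine ⟨?_, ?_⟩
    · rintro ⟨Q₁, Q₂, h1, h2, -, he⟩
      have e := h.split p hp hp0 hc Q₁ Q₂ h1 h2 he
      simp only []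
      rw [e, map_natCast, Ideal.absNorm_apply, Submodule.cardQuot_apply]
    · intro hJ
      have e := h.inert p hp hp0 hc hJ
      simp only []
      rw [e, map_neg, map_natCast, Ideal.absNorm_apply, Submodule.cardQuot_apply]
  · intro I hI0 hI
    obtain ⟨a1, a2⟩ := h.psi_spec hI0 hI
    refine ⟨?_, ?_⟩
    · have e := congrArg (algebraMap (𝓞 K) K) a1.2
      rw [map_mul, map_natCast, h.coe, h.coe, h.coe, Ideal.absNorm_apply,
        Submodule.cardQuot_apply] at e
      exact e
    · simp only []
      rw [← FractionalIdeal.coeIdeal_span_singleton, a1.1, h.idealConj4, h.idealConj5]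
      rfl
  · intro I hI0 hI
    obtain ⟨a1, a2⟩ := h.psi_spec hI0 hI
    have e := h.psi_eq (map_ne_bot g hI0) (coprime_map g hI) a1.map (h.sgn_g a2)
    simp only []
    rw [h.idealConj, e, h.coe]
end
end Shim


/-- For the sextic cyclic CM field ℚ(α, √-7) of conductor 133 there exists a Shimura ideal character. -/
theorem stmt_11 (K : Type*) [Field K] [NumberField K]
    (hdeg : Module.finrank ℚ K = 6) [IsGalois ℚ K] (hcyc : IsCyclic (K ≃ₐ[ℚ] K))
    (α β : K) (hα : α ^ 3 = 57 * α - 133) (hβ : β ^ 2 = (-7 : K)) :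
    ∃ (σ : K ≃ₐ[ℚ] K) (𝔠 : Ideal (𝓞 K)) (ψ : Ideal (𝓞 K) → K),
      (∀ τ : K ≃ₐ[ℚ] K, τ ∈ Subgroup.zpowers σ) ∧ 𝔠 ≠ ⊥ ∧
      IsShimuraIdealChar σ 𝔠 ψ := by
  obtain ⟨σ, g, y, w, h⟩ := Shim.exists_SD K hdeg hcyc α β hα hβ
  refine ⟨σ, Ideal.span {(7 : 𝓞 K)}, _, h.gen, ?_, h.char⟩
  rw [Ne, Ideal.span_singleton_eq_bot]
  exact OfNat.ofNat_ne_zero 7
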